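/- For every integer n ≥ 10, every pair (x,y) ∈ ℤ² satisfying (x − F_n·y)(x − L_n·y)·x − y³ = ±1 obeys max{log|x|, log|y|} ≤ 3^{94}·2n²·log(2n²)·(2n² + (2n−1)·log α + 1). -/

import Mathlib

open Real

/-- The golden ratio α = (1+√5)/2. -/
noncomputable def alpha : ℝ := (1 + Real.sqrt 5) / 2

/-- The Lucas sequence: L 0 = 2, L 1 = 1, L (n+2) = L (n+1) + L n. -/
def lucas : ℕ → ℤ
  | 0 => 2
  | 1 => 1
  | n + 2 => lucas (n + 1) + lucas n

/-- The cubic polynomial f_n(X) = (X − F_n)(X − L_n)X − 1. -/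
noncomputable def fpoly (n : ℕ) (X : ℝ) : ℝ :=
  (X - (Nat.fib n : ℝ)) * (X - (lucas n : ℝ)) * X - 1

/-- The divided difference of `f` at the points of `s`. -/
noncomputable def divDiff (s : Finset ℝ) (f : ℝ → ℝ) : ℝ :=
  ∑ p ∈ s, f p / ∏ k ∈ s.erase p, (p - k)

theorem divDiff_one {s : Finset ℝ} (hs : 2 ≤ s.card) : divDiff s (fun _ => 1) = 0 := by
  have h := Lagrange.coeff_eq_sum (s := s) (v := id) Function.injective_id.injOn
    (P := (1 : Polynomial ℝ)) (by
      rw [Polynomial.degree_one]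
      exact_mod_cast (by omega : 0 < s.card))
  rw [Polynomial.coeff_one, if_neg (by omega)] at h
  simpa [divDiff] using h.symm

theorem divDiff_sub_mul {s : Finset ℝ} {a : ℝ} (ha : a ∈ s) (f : ℝ → ℝ) :
    divDiff s (fun x => (x - a) * f x) = divDiff (s.erase a) f := by
  unfold divDiff
  rw [← Finset.add_sum_erase s _ ha]
  simp only [sub_self, zero_mul, zero_div, zero_add]
  refine Finset.sum_congr rfl fun p hp => ?_
  have hpa : p ≠ a := Finset.ne_of_mem_erase hp
  have : a ∈ s.erase p := Finset.mem_erase.2 ⟨hpa.symm, ha⟩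
  rw [← Finset.mul_prod_erase _ _ this, Finset.erase_right_comm,
    mul_div_mul_left _ _ (sub_ne_zero.2 hpa)]

theorem divDiff_add (s : Finset ℝ) (f g : ℝ → ℝ) :
    divDiff s (fun x => f x + g x) = divDiff s f + divDiff s g := by
  simp [divDiff, add_div, Finset.sum_add_distrib]

theorem divDiff_const_mul (s : Finset ℝ) (c : ℝ) (f : ℝ → ℝ) :
    divDiff s (fun x => c * f x) = c * divDiff s f := by
  simp [divDiff, mul_div_assoc, Finset.mul_sum]

theorem abs_divDiff_pow_le {R Z : ℝ} (hR : 0 ≤ R) (hZ : 0 < Z) (ν : ℕ) :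
    ∀ s : Finset ℝ, s.Nonempty → (∀ p ∈ s, |p| ≤ R) →
      |divDiff s (fun x => x ^ ν)| * Z ^ (s.card - 1) ≤ (R + Z) ^ ν := by
  induction ν with
  | zero =>
    intro s hs _
    rcases Nat.lt_or_ge 1 s.card with h | h
    · simp [divDiff_one h]
    · obtain ⟨a, rfl⟩ := Finset.card_eq_one.1 (le_antisymm h hs.card_pos)
      simp [divDiff]
  | succ ν ih =>
    intro s hs hsR
    obtain ⟨a, ha⟩ := hs
    have h1 : divDiff s (fun x => x ^ (ν + 1)) =
        divDiff (s.erase a) (fun x => x ^ ν) + a * divDiff s (fun x => x ^ ν) := by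
      rw [← divDiff_sub_mul ha, ← divDiff_const_mul, ← divDiff_add]
      congr 1; ext x; ring
    have h2 := ih s ⟨a, ha⟩ hsR
    have h3 : |divDiff (s.erase a) (fun x => x ^ ν)| * Z ^ (s.card - 1) ≤ Z * (R + Z) ^ ν := by
      rcases (s.erase a).eq_empty_or_nonempty with h | h
      · rw [h]; simp [divDiff]; positivity
      · have := ih _ h (fun p hp => hsR p (Finset.mem_of_mem_erase hp))
        have hc : s.card - 1 = ((s.erase a).card - 1) + 1 := by
          have := h.card_pos
          rw [Finset.card_erase_of_mem ha] at *
          omega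
        rw [hc, pow_succ]
        nlinarith
    rw [h1]
    calc _ ≤ (|divDiff (s.erase a) (fun x => x ^ ν)| + R * |divDiff s (fun x => x ^ ν)|)
          * Z ^ (s.card - 1) := by
          gcongr
          refine (abs_add_le _ _).trans ?_
          rw [abs_mul]
          gcongr
          exact hsR a ha
      _ ≤ (R + Z) ^ (ν + 1) := by
          have := mul_le_mul_of_nonneg_left h2 hR
          rw [pow_succ]
          linarith

/-- `f` is the sum of an everywhere convergent power series whose coefficientwise absolute value
is at most `B` at `X`. -/
def HasMajorant (f : ℝ → ℝ) (X B : ℝ) : Prop :=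
  ∃ a : ℕ → ℝ, (∀ x, HasSum (fun ν => a ν * x ^ ν) (f x)) ∧
    ∃ b ≤ B, HasSum (fun ν => |a ν| * X ^ ν) b

theorem HasMajorant.mono {f : ℝ → ℝ} {X B B' : ℝ} (h : HasMajorant f X B) (hB : B ≤ B') :
    HasMajorant f X B' := by
  obtain ⟨a, h1, b, h2, h3⟩ := h
  exact ⟨a, h1, b, h2.trans hB, h3⟩

theorem hasMajorant_exp (c X : ℝ) :
    HasMajorant (fun x => exp (c * x)) X (exp (|c| * X)) := by
  have key : ∀ y : ℝ, HasSum (fun ν : ℕ => y ^ ν / (ν.factorial : ℝ)) (exp y) := fun y => by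
    rw [Real.exp_eq_exp_ℝ]
    exact NormedSpace.expSeries_div_hasSum_exp y
  refine ⟨fun ν => c ^ ν / (ν.factorial : ℝ), fun x => ?_, _, le_rfl, ?_⟩
  · convert key (c * x) using 2 with ν
    rw [mul_pow]; ring
  · convert key (|c| * X) using 2 with ν
    rw [mul_pow, abs_div, abs_pow, Nat.abs_cast]; ring

theorem HasMajorant.nonneg {f : ℝ → ℝ} {X B : ℝ} (hX : 0 ≤ X) (h : HasMajorant f X B) : 0 ≤ B := by
  obtain ⟨a, -, b, h2, h3⟩ := h
  exact (h3.nonneg fun ν => by positivity).trans h2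

theorem HasMajorant.abs_le {f : ℝ → ℝ} {X B : ℝ} (h : HasMajorant f X B) {x : ℝ}
    (hx : |x| ≤ X) : |f x| ≤ B := by
  obtain ⟨a, h1, b, h2, h3⟩ := h
  refine le_trans ?_ h2
  rw [← (h1 x).tsum_eq, ← h3.tsum_eq, ← Real.norm_eq_abs]
  refine tsum_of_norm_bounded h3.summable.hasSum fun ν => ?_
  rw [norm_mul, norm_pow, Real.norm_eq_abs, Real.norm_eq_abs]
  gcongr

theorem HasMajorant.abs_divDiff_le {f : ℝ → ℝ} {R Z B : ℝ} (hR : 0 ≤ R) (hZ : 0 < Z)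
    (h : HasMajorant f (R + Z) B) {s : Finset ℝ} (hs : s.Nonempty) (hsR : ∀ p ∈ s, |p| ≤ R) :
    |divDiff s f| * Z ^ (s.card - 1) ≤ B := by
  obtain ⟨a, h1, b, h2, h3⟩ := h
  refine le_trans ?_ h2
  have h4 : HasSum (fun ν => a ν * divDiff s (fun x => x ^ ν)) (divDiff s f) := by
    have := hasSum_sum (s := s) fun p _ => (h1 p).div_const (∏ k ∈ s.erase p, (p - k))
    have he : (fun ν => a ν * divDiff s (fun x => x ^ ν)) =
        fun ν => ∑ p ∈ s, a ν * p ^ ν / ∏ k ∈ s.erase p, (p - k) := by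
      funext ν
      simp [divDiff, Finset.mul_sum, mul_div_assoc]
    rw [he]
    exact this
  have h5 := h4.mul_right (Z ^ (s.card - 1))
  have h6 : |divDiff s f * Z ^ (s.card - 1)| ≤ b := by
    rw [← h5.tsum_eq, ← h3.tsum_eq, ← Real.norm_eq_abs]
    refine tsum_of_norm_bounded h3.summable.hasSum fun ν => ?_
    rw [norm_mul, norm_mul, Real.norm_eq_abs, Real.norm_eq_abs, mul_assoc,
      Real.norm_of_nonneg (by positivity : (0:ℝ) ≤ Z ^ (s.card - 1))]
    exact mul_le_mul_of_nonneg_left (abs_divDiff_pow_le hR hZ ν s hs hsR) (abs_nonneg _)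
  rwa [abs_mul, abs_of_pos (by positivity : (0:ℝ) < Z ^ (s.card - 1))] at h6

theorem HasMajorant.sub_mul {f : ℝ → ℝ} {X B : ℝ} (hX : 0 ≤ X) (h : HasMajorant f X B) {k : ℝ}
    (hk : 0 ≤ k) : HasMajorant (fun x => (x - k) * f x) X ((X + k) * B) := by
  obtain ⟨a, h1, b, h2, h3⟩ := h
  set a' : ℕ → ℝ := fun ν => Nat.casesOn ν 0 a with ha'
  have h1' : ∀ x, HasSum (fun ν => a' ν * x ^ ν) (x * f x) := fun x => by
    rw [← hasSum_nat_add_iff' 1]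
    have he : (fun ν => a' (ν + 1) * x ^ (ν + 1)) = fun ν => x * (a ν * x ^ ν) := by
      funext ν
      simp only [ha', pow_succ]; ring
    rw [he]
    simpa [ha'] using (h1 x).mul_left x
  have h3' : HasSum (fun ν => |a' ν| * X ^ ν) (X * b) := by
    rw [← hasSum_nat_add_iff' 1]
    have he : (fun ν => |a' (ν + 1)| * X ^ (ν + 1)) = fun ν => X * (|a ν| * X ^ ν) := by
      funext ν
      simp only [ha', pow_succ]; ring
    rw [he]
    simpa [ha'] using h3.mul_left X
  have h6 := h3'.add (h3.mul_left k)
  have hle : ∀ ν, |a' ν - k * a ν| * X ^ ν ≤ |a' ν| * X ^ ν + k * (|a ν| * X ^ ν) := fun ν => by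
    have : |a' ν - k * a ν| ≤ |a' ν| + k * |a ν| := by
      refine (abs_sub _ _).trans ?_
      rw [abs_mul, abs_of_nonneg hk]
    nlinarith [pow_nonneg hX ν]
  have hs : Summable (fun ν => |a' ν - k * a ν| * X ^ ν) :=
    Summable.of_nonneg_of_le (fun ν => by positivity) hle h6.summable
  refine ⟨fun ν => a' ν - k * a ν, fun x => ?_, _, ?_, hs.hasSum⟩
  · have he : (fun ν => (a' ν - k * a ν) * x ^ ν) =
        fun ν => a' ν * x ^ ν - k * (a ν * x ^ ν) := by
      funext ν; ring
    rw [he]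
    change HasSum _ ((x - k) * f x)
    rw [_root_.sub_mul]
    exact (h1' x).sub ((h1 x).mul_left k)
  · refine (hasSum_le hle hs.hasSum h6).trans ?_
    nlinarith

theorem HasMajorant.const_mul {f : ℝ → ℝ} {X B : ℝ} (h : HasMajorant f X B) {k : ℝ}
    (hk : 0 ≤ k) : HasMajorant (fun x => k * f x) X (k * B) := by
  obtain ⟨a, h1, b, h2, h3⟩ := h
  refine ⟨fun ν => k * a ν, fun x => ?_, k * b, by gcongr, ?_⟩
  · simpa [mul_assoc] using (h1 x).mul_left k
  · simpa [mul_assoc, abs_mul, abs_of_nonneg hk] using h3.mul_left k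

/-- The binomial coefficient `x` over `k` as a polynomial function. -/
noncomputable def realChoose (x : ℝ) (k : ℕ) : ℝ := (descPochhammer ℝ k).eval x / k.factorial

theorem realChoose_natCast (n k : ℕ) : realChoose n k = n.choose k := by
  rw [realChoose, Nat.cast_choose_eq_descPochhammer_div]

theorem pow_div_factorial_le {x : ℝ} {k K : ℕ} (hk : k ≤ K) (hK : 0 < K) (hx : K ≤ x) :
    x ^ k / k.factorial ≤ (exp 1 * x / K) ^ K := by
  have hK' : (0:ℝ) < K := by exact_mod_cast hK
  have h1 : (K:ℝ) ^ k / k.factorial ≤ exp K := Real.pow_div_factorial_le_exp K hK'.le k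
  have h2 : 1 ≤ x / K := (one_le_div hK').2 hx
  calc x ^ k / k.factorial = (x / K) ^ k * ((K:ℝ) ^ k / k.factorial) := by
        rw [div_pow, div_mul_div_comm, mul_comm ((K:ℝ) ^ k), mul_div_mul_right _ _ (by positivity)]
    _ ≤ (x / K) ^ K * exp K := by gcongr
    _ = (exp 1 * x / K) ^ K := by
        rw [mul_div_assoc, mul_pow, ← Real.exp_nat_mul, mul_one, mul_comm]

theorem hasMajorant_realChoose_mul_exp (c : ℝ) {X : ℝ} (hX : 0 ≤ X) {k K : ℕ} (hk : k < K) :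
    HasMajorant (fun x => realChoose x k * exp (c * x)) X
      ((exp 1 * (X + K) / K) ^ K * exp (|c| * X)) := by
  have key : ∀ j ≤ K, HasMajorant (fun x => (∏ i ∈ Finset.range j, (x - i)) * exp (c * x)) X
      ((X + K) ^ j * exp (|c| * X)) := by
    intro j
    induction j with
    | zero => intro _; simpa using hasMajorant_exp c X
    | succ j ih =>
      intro hj
      have h := ((ih (by omega)).sub_mul hX (Nat.cast_nonneg j)).mono
        (B' := (X + K) ^ (j + 1) * exp (|c| * X)) (by
          rw [pow_succ', mul_assoc]
          have : (j:ℝ) ≤ K := by exact_mod_cast (by omega : j ≤ K)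
          gcongr)
      convert h using 2 with x
      rw [Finset.prod_range_succ]; ring
  have h := ((key k hk.le).const_mul (k := 1 / (k.factorial : ℝ)) (by positivity)).mono
    (B' := (exp 1 * (X + K) / K) ^ K * exp (|c| * X)) (by
      rw [← mul_assoc, one_div_mul_eq_div]
      gcongr
      exact pow_div_factorial_le hk.le (by omega) (by linarith))
  convert h using 2 with x
  rw [realChoose, descPochhammer_eval_eq_prod_range]; ring

theorem factorial_card_le_prod {s : Finset ℕ} (hs : 0 ∉ s) : s.card.factorial ≤ ∏ k ∈ s, k := by
  induction s using Finset.induction_on_max with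
  | empty => simp
  | insert a s ha ih =>
    have has : a ∉ s := fun h => lt_irrefl _ (ha a h)
    rw [Finset.card_insert_of_notMem has, Finset.prod_insert has, Nat.factorial_succ]
    refine Nat.mul_le_mul ?_ (ih fun h => hs (Finset.mem_insert_of_mem h))
    have hsub : s ⊆ Finset.Ioo 0 a := fun k hk => Finset.mem_Ioo.2
      ⟨Nat.pos_of_ne_zero fun h => hs (Finset.mem_insert_of_mem (h ▸ hk)), ha k hk⟩
    have h1 := Finset.card_le_card hsub
    have h2 : a ≠ 0 := fun h => hs (h ▸ Finset.mem_insert_self _ _)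
    rw [Nat.card_Ioo] at h1
    omega

theorem factorial_card_le_two_pow_mul_prod {s : Finset ℕ} {p : ℕ} (hp : p ∉ s) :
    (s.card.factorial : ℝ) ≤ 2 ^ s.card * ∏ k ∈ s, |(p : ℝ) - k| := by
  have side : ∀ t ⊆ s, ∀ g : ℕ → ℕ, Set.InjOn g t → (∀ k ∈ t, g k ≠ 0 ∧ (g k : ℝ) = |(p : ℝ) - k|) →
      (t.card.factorial : ℝ) ≤ ∏ k ∈ t, |(p : ℝ) - k| := by
    intro t _ g hg hk
    have h := factorial_card_le_prod (s := t.image g) (by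
      simp only [Finset.mem_image, not_exists, not_and]
      exact fun k hkt => (hk k hkt).1)
    rw [Finset.card_image_of_injOn hg, Finset.prod_image hg] at h
    calc (t.card.factorial : ℝ) ≤ ((∏ k ∈ t, g k : ℕ) : ℝ) := by exact_mod_cast h
      _ = _ := by
        rw [Nat.cast_prod]
        exact Finset.prod_congr rfl fun k hkt => (hk k hkt).2
  have h1 := side (s.filter (· < p)) (Finset.filter_subset _ _) (fun k => p - k)
    (fun a ha b hb hab => by
      have := (Finset.mem_filter.1 ha).2
      have := (Finset.mem_filter.1 hb).2
      dsimp only at hab; omega)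
    (fun k hk => by
      have hlt := (Finset.mem_filter.1 hk).2
      refine ⟨by omega, ?_⟩
      rw [Nat.cast_sub hlt.le, abs_of_nonneg (sub_nonneg.2 (by exact_mod_cast hlt.le))])
  have h2 := side (s.filter (¬ · < p)) (Finset.filter_subset _ _) (fun k => k - p)
    (fun a ha b hb hab => by
      have := (Finset.mem_filter.1 ha).2
      have := (Finset.mem_filter.1 hb).2
      dsimp only at hab; omega)
    (fun k hk => by
      have hle := (Finset.mem_filter.1 hk).2
      have hne : k ≠ p := fun h => hp (h ▸ (Finset.mem_filter.1 hk).1)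
      refine ⟨by omega, ?_⟩
      rw [Nat.cast_sub (by omega), abs_sub_comm,
        abs_of_nonneg (sub_nonneg.2 (by exact_mod_cast not_lt.1 hle))])
  rw [← Finset.prod_filter_mul_prod_filter_not s (· < p)]
  have hc := Finset.card_filter_add_card_filter_not (s := s) (· < p)
  set a := (s.filter (· < p)).card
  set b := (s.filter (¬ · < p)).card
  rw [← hc]
  have h3 := Nat.add_choose_mul_factorial_mul_factorial a b
  have h4 := Nat.choose_le_two_pow (a + b) b
  calc ((a + b).factorial : ℝ) = (a + b).choose b * (a.factorial * b.factorial) := by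
        rw [← h3]; push_cast; ring
    _ ≤ 2 ^ (a + b) * (a.factorial * b.factorial) := by
        gcongr
        exact_mod_cast h4
    _ ≤ _ := by gcongr

open Finset in
theorem abs_det_le_of_hasMajorant {N : ℕ} (hN : 0 < N) {z : Fin N → ℕ} (hz : Function.Injective z)
    {R E B θ : ℝ} (hR : 0 < R) (hE : 0 < E) (hzR : ∀ p, (z p : ℝ) ≤ R) {f : Fin N → ℝ → ℝ}
    (hf : ∀ i, HasMajorant (f i) (R + E * R) B) {M : Matrix (Fin N) (Fin N) ℝ}
    (hM : ∀ i p, |M i p - f i (z p)| ≤ θ) (hNE : N ≤ 2 * (E * R))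
    (hθ : θ * N * (exp 1 * (2 * (E * R)) / N) ^ N ≤ B) :
    |M.det| * E ^ (∑ j : Fin N, (j : ℕ)) ≤ N.factorial * (2 * B) ^ N := by
  have hB : 0 ≤ B := (hf ⟨0, hN⟩).nonneg (by positivity)
  have hθ0 : 0 ≤ θ := (abs_nonneg _).trans (hM ⟨0, hN⟩ ⟨0, hN⟩)
  set C : Matrix (Fin N) (Fin N) ℝ := fun p j =>
    if p ≤ j then 1 / ∏ k ∈ (Iic j).erase p, ((z p : ℝ) - z k) else 0 with hC
  have hzinj : Function.Injective (fun p => (z p : ℝ)) := Nat.cast_injective.comp hz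
  have hdetC : C.det = ∏ j, 1 / ∏ k ∈ Iio j, ((z j : ℝ) - z k) := by
    rw [Matrix.det_of_isUpperTriangular]
    · refine prod_congr rfl fun j _ => ?_
      simp [hC, Iic_erase]
    · intro i j hij
      simp only [hC]
      rw [if_neg (not_le.2 (show j < i from hij))]
  have hdetC' : 1 ≤ |C.det| * R ^ (∑ j : Fin N, (j : ℕ)) := by
    rw [hdetC, abs_prod, ← prod_pow_eq_pow_sum, ← prod_mul_distrib]
    refine (Finset.prod_const_one (s := (univ : Finset (Fin N)))).symm.le.trans
      (prod_le_prod (fun _ _ => zero_le_one) fun j _ => ?_)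
    have hpos : 0 < ∏ k ∈ Iio j, |(z j : ℝ) - z k| := prod_pos fun k hk =>
      abs_pos.2 (sub_ne_zero.2 fun h => (mem_Iio.1 hk).ne' (hzinj h))
    rw [abs_div, abs_one, abs_prod, one_div_mul_eq_div, one_le_div hpos]
    calc _ ≤ ∏ k ∈ Iio j, R := prod_le_prod (fun _ _ => abs_nonneg _) fun k _ => by
          have := hzR k; have := hzR j
          have : (0:ℝ) ≤ z k := Nat.cast_nonneg _
          have : (0:ℝ) ≤ z j := Nat.cast_nonneg _
          rw [abs_le]; constructor <;> linarith
      _ = R ^ (j : ℕ) := by simp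
  have hentry : ∀ i j, |(M * C) i j| * (E * R) ^ (j : ℕ) ≤ 2 * B := by
    intro i j
    have h1 : (M * C) i j = divDiff ((Iic j).image fun p => (z p : ℝ)) (f i) +
        ∑ p ∈ Iic j, (M i p - f i (z p)) / ∏ k ∈ (Iic j).erase p, ((z p : ℝ) - z k) := by
      rw [divDiff, sum_image hzinj.injOn, ← sum_add_distrib, Matrix.mul_apply]
      rw [← sum_subset (subset_univ (Iic j))]
      · refine sum_congr rfl fun p hp => ?_
        have he : ((Iic j).image fun p => (z p : ℝ)).erase (z p) =
            ((Iic j).erase p).image fun p => (z p : ℝ) := (image_erase hzinj _ _).symm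
        rw [he, prod_image hzinj.injOn]
        simp only [hC, if_pos (mem_Iic.1 hp)]
        ring
      · intro p _ hp
        simp only [hC, if_neg fun h => hp (mem_Iic.2 h), mul_zero]
    have h2 := (hf i).abs_divDiff_le hR.le (by positivity) (s := (Iic j).image fun p => (z p : ℝ))
      ⟨_, mem_image_of_mem _ (mem_Iic.2 le_rfl)⟩ (by
        intro p hp
        obtain ⟨q, -, rfl⟩ := mem_image.1 hp
        rw [Nat.abs_cast]
        exact hzR q)
    rw [card_image_of_injective _ hzinj, Fin.card_Iic, Nat.add_sub_cancel] at h2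
    have h3 : |∑ p ∈ Iic j, (M i p - f i (z p)) / ∏ k ∈ (Iic j).erase p, ((z p : ℝ) - z k)|
        * (E * R) ^ (j : ℕ) ≤ B := by
      have hterm : ∀ p ∈ Iic j,
          |(M i p - f i (z p)) / ∏ k ∈ (Iic j).erase p, ((z p : ℝ) - z k)|
            ≤ θ * (2 ^ (j : ℕ) / (j : ℕ).factorial) := by
        intro p hp
        have h4 := factorial_card_le_two_pow_mul_prod (s := ((Iic j).erase p).image z) (p := z p)
          (by simp [hz.eq_iff])
        rw [card_image_of_injective _ hz, prod_image hz.injOn, card_erase_of_mem hp, Fin.card_Iic,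
          Nat.add_sub_cancel] at h4
        have hpos : 0 < ∏ k ∈ (Iic j).erase p, |(z p : ℝ) - z k| := prod_pos fun k hk =>
          abs_pos.2 (sub_ne_zero.2 fun h => (mem_erase.1 hk).1 (hzinj h).symm)
        rw [abs_div, abs_prod, div_eq_mul_inv]
        refine mul_le_mul (hM i p) ?_ (by positivity) hθ0
        rw [inv_le_comm₀ hpos (by positivity), inv_div, div_le_iff₀' (by positivity)]
        exact h4
      calc _ ≤ (∑ p ∈ Iic j, θ * (2 ^ (j : ℕ) / (j : ℕ).factorial)) * (E * R) ^ (j : ℕ) := by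
            gcongr
            exact (abs_sum_le_sum_abs _ _).trans (sum_le_sum hterm)
        _ = θ * ((j : ℕ) + 1 : ℕ) * ((2 * (E * R)) ^ (j : ℕ) / (j : ℕ).factorial) := by
            rw [sum_const, Fin.card_Iic, nsmul_eq_mul, mul_pow 2 (E * R)]; ring
        _ ≤ θ * N * (exp 1 * (2 * (E * R)) / N) ^ N := by
            have h5 := pow_div_factorial_le (k := j) j.2.le hN hNE
            have h6 : (((j : ℕ) + 1 : ℕ) : ℝ) ≤ N := by exact_mod_cast j.2
            gcongr
        _ ≤ B := hθ
    rw [h1]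
    refine (mul_le_mul_of_nonneg_right (abs_add_le _ _) (by positivity)).trans ?_
    linarith
  have hMC : |(M * C).det| * (E * R) ^ (∑ j : Fin N, (j : ℕ)) ≤ N.factorial * (2 * B) ^ N := by
    rw [Matrix.det_apply']
    calc _ ≤ (∑ σ : Equiv.Perm (Fin N), ∏ j, |(M * C) (σ j) j|)
          * (E * R) ^ (∑ j : Fin N, (j : ℕ)) := by
          gcongr
          refine (abs_sum_le_sum_abs _ _).trans (sum_le_sum fun σ _ => ?_)
          rw [abs_mul, abs_prod]
          rcases Int.units_eq_one_or (Equiv.Perm.sign σ) with h | h <;> simp [h]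
      _ = ∑ σ : Equiv.Perm (Fin N), ∏ j, (|(M * C) (σ j) j| * (E * R) ^ (j : ℕ)) := by
          rw [sum_mul]
          refine sum_congr rfl fun σ _ => ?_
          rw [← prod_pow_eq_pow_sum, prod_mul_distrib]
      _ ≤ ∑ σ : Equiv.Perm (Fin N), ∏ j : Fin N, (2 * B) := sum_le_sum fun σ _ =>
          prod_le_prod (fun _ _ => by positivity) fun j _ => hentry _ _
      _ = _ := by simp [Fintype.card_perm]
  rw [Matrix.det_mul, abs_mul, mul_pow] at hMC
  refine le_trans ?_ hMC
  calc _ = |M.det| * E ^ (∑ j : Fin N, (j : ℕ)) * 1 := (mul_one _).symm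
    _ ≤ |M.det| * E ^ (∑ j : Fin N, (j : ℕ)) * (|C.det| * R ^ (∑ j : Fin N, (j : ℕ))) := by gcongr
    _ = _ := by ring

theorem exists_submatrix_det_ne_zero {N : ℕ} {κ : Type*} [Fintype κ] (M : Matrix (Fin N) κ ℝ)
    (hM : ∀ p : Fin N → ℝ, (∀ q, ∑ i, p i * M i q = 0) → p = 0) :
    ∃ g : Fin N → κ, (M.submatrix id g).det ≠ 0 := by
  have hrow : LinearIndependent ℝ M.row := by
    rw [Fintype.linearIndependent_iff]
    intro p hp i
    refine congrFun (hM p fun q => ?_) i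
    simpa [Matrix.row] using congrFun hp q
  have hrank := hrow.rank_matrix
  rw [Matrix.rank_eq_finrank_span_cols, Fintype.card_fin] at hrank
  have key := Submodule.exists_fun_fin_finrank_span_eq ℝ (Set.range M.col)
  rw [hrank] at key
  obtain ⟨f, hf, -, hli⟩ := key
  choose g hg using hf
  refine ⟨g, ?_⟩
  have hcols : f = (M.submatrix id g).col := by
    funext j
    rw [← hg j]
    rfl
  rw [hcols, Matrix.linearIndependent_cols_iff_isUnit, Matrix.isUnit_iff_isUnit_det] at hli
  exact hli.ne_zero

open Polynomial in
theorem eq_zero_of_forall_sum_realChoose_eq_zero {m γ : ℝ} (hm : 0 < m) (hm1 : m ≠ 1)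
    (hγ : γ ≠ 0) {K L S U r : ℕ} (hS : S ≤ r) (hKL : K * L ≤ S * U) (p : Fin K → Fin L → ℝ)
    (hp : ∀ s < S + L - 1, ∀ u < U, ∑ k, ∑ l, p k l *
      (realChoose ((s + r * u : ℕ) : ℝ) k * m ^ ((l : ℕ) * s) * γ ^ ((l : ℕ) * u)) = 0) :
    p = 0 := by
  classical
  set Q : Fin L → ℝ[X] := fun l => ∑ k : Fin K,
    C (p k l / ((k : ℕ).factorial : ℝ)) * descPochhammer ℝ k with hQ
  have hQeval : ∀ l x, (Q l).eval x = ∑ k, p k l * realChoose x k := by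
    intro l x
    simp only [hQ, eval_finsetSum, eval_mul, eval_C, realChoose]
    exact Finset.sum_congr rfl fun k _ => by ring
  have hQdeg : ∀ l, (Q l).natDegree ≤ K - 1 := by
    intro l
    refine natDegree_sum_le_of_forall_le _ _ fun k _ => ?_
    refine (natDegree_C_mul_le _ _).trans ?_
    rw [descPochhammer_natDegree]
    omega
  have hQzero : (∀ l, Q l = 0) → p = 0 := by
    intro h
    funext k l
    have hnat : ∀ n : ℕ, ∀ hn : n < K, p ⟨n, hn⟩ l = 0 := by
      intro n
      induction n using Nat.strong_induction_on with
      | _ n ih =>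
        intro hn
        have h1 := hQeval l n
        rw [h l, eval_zero, Finset.sum_eq_single ⟨n, hn⟩] at h1
        · simpa [realChoose_natCast] using h1.symm
        · intro k _ hk
          rcases lt_trichotomy (k : ℕ) n with hlt | heq | hgt
          · rw [show p k l = 0 from ih k hlt k.2, zero_mul]
          · exact absurd (Fin.ext heq) hk
          · rw [realChoose_natCast, Nat.choose_eq_zero_of_lt hgt]; simp
        · simp
    exact hnat k k.2
  by_contra hne
  set T : Finset (Fin L) := Finset.univ.filter fun l => Q l ≠ 0 with hT
  have hTpos : 0 < T.card := by
    rw [Finset.card_pos]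
    by_contra h
    rw [Finset.not_nonempty_iff_eq_empty] at h
    refine hne (hQzero fun l => ?_)
    by_contra hl
    have : l ∈ T := Finset.mem_filter.2 ⟨Finset.mem_univ _, hl⟩
    simp [h] at this
  have hK : 0 < K := by
    rcases Nat.eq_zero_or_pos K with rfl | h
    · exact absurd (Subsingleton.elim _ _) hne
    · exact h
  have hTL : T.card ≤ L := by simpa using T.card_le_univ
  set c : Fin T.card → Fin L := fun j => (T.equivFin.symm j : Fin L) with hc
  have hcinj : Function.Injective c := fun a b h =>
    T.equivFin.symm.injective (Subtype.ext h)
  have hcQ : ∀ j, Q (c j) ≠ 0 := fun j => (Finset.mem_filter.1 (T.equivFin.symm j).2).2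
  set A : Matrix (Fin T.card) (Fin T.card) ℝ[X] := Matrix.of fun i j =>
    (Q (c j)).comp (X + C ((i : ℕ) : ℝ)) * C (m ^ ((c j : ℕ) * i)) with hA
  have hAeval : ∀ x : ℝ, A.det.eval x = (Matrix.of fun i j : Fin T.card =>
      (Q (c j)).eval (x + (i : ℕ)) * m ^ ((c j : ℕ) * i)).det := by
    intro x
    rw [← coe_evalRingHom, RingHom.map_det]
    congr 1
    ext i j
    simp [hA]
  have hdeg : A.det.natDegree ≤ (K - 1) * T.card := by
    rw [Matrix.det_apply]
    refine natDegree_sum_le_of_forall_le _ _ fun σ _ => ?_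
    refine (natDegree_smul_le _ _).trans ?_
    refine (natDegree_prod_le _ _).trans ?_
    refine (Finset.sum_le_card_nsmul _ _ (K - 1) fun i _ => ?_).trans (by simp [mul_comm])
    simp only [hA, Matrix.of_apply]
    refine (natDegree_mul_C_le _ _).trans ?_
    rw [natDegree_comp, natDegree_X_add_C, mul_one]
    exact hQdeg _
  have hroot : ∀ q : Fin S × Fin U, A.det.eval (((q.1 : ℕ) + r * (q.2 : ℕ) : ℕ) : ℝ) = 0 := by
    rintro ⟨s, u⟩
    rw [hAeval]
    refine Matrix.exists_mulVec_eq_zero_iff.1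
      ⟨fun j => m ^ ((c j : ℕ) * s) * γ ^ ((c j : ℕ) * u), fun h => ?_, ?_⟩
    · have := congrFun h ⟨0, hTpos⟩
      simp [hm.ne', hγ] at this
    · funext i
      have h1 := hp (s + i) (by have := s.2; have := i.2; omega) u u.2
      rw [Finset.sum_comm] at h1
      rw [Matrix.mulVec, dotProduct, Pi.zero_apply, ← h1]
      have h2 : ∀ l, ∑ k, p k l * (realChoose ((s + i + r * u : ℕ) : ℝ) k *
          m ^ ((l : ℕ) * (s + i)) * γ ^ ((l : ℕ) * u)) =
          (Q l).eval (((s + r * u : ℕ) : ℝ) + (i : ℕ)) * m ^ ((l : ℕ) * i) *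
            (m ^ ((l : ℕ) * s) * γ ^ ((l : ℕ) * u)) := by
        intro l
        rw [hQeval, Finset.sum_mul, Finset.sum_mul]
        refine Finset.sum_congr rfl fun k _ => ?_
        rw [mul_add, pow_add]
        push_cast
        ring_nf
      rw [Finset.sum_congr rfl fun l _ => h2 l, ← Finset.sum_subset (Finset.subset_univ T)]
      · rw [← Finset.sum_coe_sort T, ← Equiv.sum_comp T.equivFin.symm]
        rfl
      · intro l _ hl
        have : Q l = 0 := by
          by_contra h
          exact hl (Finset.mem_filter.2 ⟨Finset.mem_univ _, h⟩)
        simp [this]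
  have hzero : A.det = 0 := by
    refine eq_zero_of_natDegree_lt_card_of_eval_eq_zero _ (ι := Fin S × Fin U) ?_ hroot ?_
    · rintro ⟨s, u⟩ ⟨s', u'⟩ h
      have h1 : (s : ℕ) + r * u = s' + r * u' := Nat.cast_injective (R := ℝ) h
      have hs : (s : ℕ) < r := s.2.trans_le hS
      have hs' : (s' : ℕ) < r := s'.2.trans_le hS
      have h2 : (s : ℕ) = s' := by
        have := congrArg (· % r) h1
        simpa [Nat.add_mul_mod_self_left, Nat.mod_eq_of_lt hs, Nat.mod_eq_of_lt hs'] using this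
      have h3 : (u : ℕ) = u' := by
        rw [h2] at h1
        exact Nat.eq_of_mul_eq_mul_left (by omega) (Nat.add_left_cancel h1)
      exact Prod.ext (Fin.ext h2) (Fin.ext h3)
    · rw [Fintype.card_prod, Fintype.card_fin, Fintype.card_fin]
      calc _ ≤ (K - 1) * T.card := hdeg
        _ < K * T.card := Nat.mul_lt_mul_of_pos_right (by omega) hTpos
        _ ≤ K * L := Nat.mul_le_mul_left _ hTL
        _ ≤ _ := hKL
  set V : Matrix (Fin T.card) (Fin T.card) ℝ := Matrix.of fun i j =>
    m ^ ((c j : ℕ) * i) * (Q (c j)).leadingCoeff with hV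
  have hVne : V.det ≠ 0 := by
    have h1 : V = (Matrix.vandermonde fun j => m ^ (c j : ℕ)).transpose *
        Matrix.diagonal fun j => (Q (c j)).leadingCoeff := by
      ext i j
      simp [hV, Matrix.vandermonde, pow_mul]
    rw [h1, Matrix.det_mul, Matrix.det_transpose, Matrix.det_diagonal]
    refine mul_ne_zero (Matrix.det_vandermonde_ne_zero_iff.2 fun a b h => ?_)
      (Finset.prod_ne_zero_iff.2 fun j _ => leadingCoeff_ne_zero.2 (hcQ j))
    exact hcinj (Fin.ext (pow_right_injective₀ hm hm1 h))
  have hlim : Filter.Tendsto (fun x : ℝ => (Matrix.of fun i j : Fin T.card =>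
      m ^ ((c j : ℕ) * i) * ((Q (c j)).eval (x + (i : ℕ)) / x ^ (Q (c j)).natDegree)).det)
      Filter.atTop (nhds V.det) := by
    refine ((continuous_id.matrix_det).tendsto V).comp ?_
    refine tendsto_pi_nhds.2 fun i => tendsto_pi_nhds.2 fun j => ?_
    refine Filter.Tendsto.const_mul _ ?_
    have h1 := div_tendsto_atTop_leadingCoeff_div_of_degree_eq
      ((Q (c j)).comp (X + C ((i : ℕ) : ℝ))) (X ^ (Q (c j)).natDegree) (by
        rw [degree_X_pow, degree_eq_natDegree, natDegree_comp, natDegree_X_add_C, mul_one]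
        rw [Ne, comp_X_add_C_eq_zero_iff]
        exact hcQ j)
    rw [leadingCoeff_X_pow, div_one, leadingCoeff_comp (by rw [natDegree_X_add_C]; exact one_ne_zero),
      leadingCoeff_X_add_C, one_pow,
      mul_one] at h1
    simpa using h1
  refine hVne (tendsto_nhds_unique hlim ?_)
  refine tendsto_const_nhds.congr' ?_
  filter_upwards with x
  have h1 : (Matrix.of fun i j : Fin T.card =>
      m ^ ((c j : ℕ) * i) * ((Q (c j)).eval (x + (i : ℕ)) / x ^ (Q (c j)).natDegree)) =
      (Matrix.of fun i j : Fin T.card =>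
        (Q (c j)).eval (x + (i : ℕ)) * m ^ ((c j : ℕ) * i)) *
      Matrix.diagonal fun j => (x ^ (Q (c j)).natDegree)⁻¹ := by
    ext i j
    simp only [Matrix.of_apply, Matrix.mul_diagonal]
    ring
  rw [h1, Matrix.det_mul, ← hAeval, hzero, eval_zero, zero_mul]

/-- The ring of families of conjugates `σ ↦ P (lam ∘ σ)` of integer polynomial values at `lam`. -/
noncomputable def conjRing (lam : Fin 3 → ℝ) : Subring (Equiv.Perm (Fin 3) → ℝ) :=
  (RingHom.range (RingHom.pi fun σ : Equiv.Perm (Fin 3) =>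
    (MvPolynomial.aeval (R := ℤ) (lam ∘ σ)).toRingHom))

theorem coord_mem_conjRing (lam : Fin 3 → ℝ) (i : Fin 3) :
    (fun σ : Equiv.Perm (Fin 3) => lam (σ i)) ∈ conjRing lam :=
  ⟨MvPolynomial.X i, funext fun σ => MvPolynomial.aeval_X (lam ∘ σ) i⟩

theorem exists_intCast_eq_aeval_of_isSymmetric {lam : Fin 3 → ℝ}
    (hlam : ∀ i : Fin 3, ∃ z : ℤ, (z : ℝ) =
      MvPolynomial.aeval lam (MvPolynomial.esymm (Fin 3) ℤ (i + 1)))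
    {P : MvPolynomial (Fin 3) ℤ} (hP : P.IsSymmetric) :
    ∃ z : ℤ, (z : ℝ) = MvPolynomial.aeval lam P := by
  choose e he using hlam
  obtain ⟨Q, hQ⟩ := MvPolynomial.esymmAlgHom_surjective (σ := Fin 3) ℤ (n := 3) (by simp) ⟨P, hP⟩
  have h1 : P = MvPolynomial.aeval
      (fun i : Fin 3 => MvPolynomial.esymm (Fin 3) ℤ (i + 1)) Q := by
    rw [← MvPolynomial.esymmAlgHom_apply, hQ]
  refine ⟨MvPolynomial.aeval e Q, ?_⟩
  rw [h1, MvPolynomial.aeval_def, MvPolynomial.aeval_def, MvPolynomial.aeval_def]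
  have h2 := MvPolynomial.hom_eval₂ Q (algebraMap ℤ ℤ) (Int.castRingHom ℝ) e
  have h3 := MvPolynomial.hom_eval₂ Q (algebraMap ℤ (MvPolynomial (Fin 3) ℤ))
    (MvPolynomial.aeval (R := ℤ) lam).toRingHom
    (fun i : Fin 3 => MvPolynomial.esymm (Fin 3) ℤ (i + 1))
  have h4 : (fun i : Fin 3 => (MvPolynomial.aeval (R := ℤ) lam).toRingHom
      (MvPolynomial.esymm (Fin 3) ℤ (i + 1))) = fun i => Int.castRingHom ℝ (e i) := by
    funext i
    exact (he i).symm
  rw [h4, RingHom.ext_int (((MvPolynomial.aeval (R := ℤ) lam).toRingHom).comp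
    (algebraMap ℤ (MvPolynomial (Fin 3) ℤ))) ((Int.castRingHom ℝ).comp (algebraMap ℤ ℤ))] at h3
  exact h2.trans h3.symm

open Polynomial in
theorem one_le_abs_mul_pow_of_mem_conjRing {lam : Fin 3 → ℝ}
    (hlam : ∀ i : Fin 3, ∃ z : ℤ, (z : ℝ) =
      MvPolynomial.aeval lam (MvPolynomial.esymm (Fin 3) ℤ (i + 1)))
    {w : Equiv.Perm (Fin 3) → ℝ} (hw : w ∈ conjRing lam) (hw1 : w 1 ≠ 0) {X : ℝ} (hX : 1 ≤ X)
    (hwX : ∀ σ, |w σ| ≤ X) : 1 ≤ |w 1| * X ^ 5 := by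
  classical
  obtain ⟨P, rfl⟩ := hw
  set w : Equiv.Perm (Fin 3) → ℝ := fun σ => MvPolynomial.aeval (lam ∘ σ) P with hw
  change w 1 ≠ 0 at hw1
  change ∀ σ, |w σ| ≤ X at hwX
  change 1 ≤ |w 1| * X ^ 5
  set G : (MvPolynomial (Fin 3) ℤ)[X] := ∏ σ : Equiv.Perm (Fin 3),
    (Polynomial.X - C (MvPolynomial.rename σ P)) with hG
  have hsymm : ∀ n, (G.coeff n).IsSymmetric := by
    intro n τ
    have h1 : G.map (MvPolynomial.rename τ : MvPolynomial (Fin 3) ℤ →ₐ[ℤ] _).toRingHom = G := by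
      rw [hG, Polynomial.map_prod, ← Equiv.prod_comp (Equiv.mulLeft τ)
        (fun σ : Equiv.Perm (Fin 3) => (Polynomial.X - C (MvPolynomial.rename σ P)))]
      refine Finset.prod_congr rfl fun σ _ => ?_
      simp only [Polynomial.map_sub, Polynomial.map_X, Polynomial.map_C]
      congr 2
      exact MvPolynomial.rename_rename _ _ _
    conv_rhs => rw [← h1]
    rw [Polynomial.coeff_map]
    rfl
  have hmap : G.map (MvPolynomial.aeval (R := ℤ) lam).toRingHom =
      ∏ σ, (Polynomial.X - C (w σ)) := by
    rw [hG, Polynomial.map_prod]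
    refine Finset.prod_congr rfl fun σ _ => ?_
    simp only [Polynomial.map_sub, Polynomial.map_X, Polynomial.map_C]
    congr 2
    exact MvPolynomial.aeval_rename _ _ _
  set s : Finset (Equiv.Perm (Fin 3)) := Finset.univ.filter fun σ => w σ ≠ 0 with hs
  obtain ⟨z, hz⟩ := exists_intCast_eq_aeval_of_isSymmetric hlam
    (hsymm (Finset.univ.filter fun σ => ¬ w σ ≠ 0).card)
  have hcoeff : (z : ℝ) = ∏ σ ∈ s, (-w σ) := by
    rw [hz]
    have h1 : (G.map (MvPolynomial.aeval (R := ℤ) lam).toRingHom).coeff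
        (0 + (Finset.univ.filter fun σ => ¬ w σ ≠ 0).card) = ∏ σ ∈ s, (-w σ) := by
      rw [hmap, ← Finset.prod_filter_mul_prod_filter_not Finset.univ (fun σ => w σ ≠ 0),
        Finset.prod_congr (s₁ := Finset.univ.filter fun σ => ¬ w σ ≠ 0) (g := fun _ => Polynomial.X)
          rfl, Finset.prod_const, coeff_mul_X_pow, coeff_zero_eq_eval_zero, eval_prod]
      · exact Finset.prod_congr rfl fun σ _ => by simp
      · intro σ hσ
        have : w σ = 0 := not_not.1 (Finset.mem_filter.1 hσ).2
        simp [this]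
    rw [← h1, Polynomial.coeff_map, zero_add]
    rfl
  have hz0 : z ≠ 0 := by
    intro h
    rw [h, Int.cast_zero] at hcoeff
    obtain ⟨σ, hσ, h0⟩ := Finset.prod_eq_zero_iff.1 hcoeff.symm
    exact (Finset.mem_filter.1 hσ).2 (neg_eq_zero.1 h0)
  have hz1 : (1 : ℝ) ≤ |(z : ℝ)| := by exact_mod_cast Int.one_le_abs hz0
  have h1s : (1 : Equiv.Perm (Fin 3)) ∈ s := Finset.mem_filter.2 ⟨Finset.mem_univ _, hw1⟩
  rw [hcoeff, Finset.abs_prod, ← Finset.mul_prod_erase _ _ h1s, abs_neg] at hz1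
  refine hz1.trans (mul_le_mul_of_nonneg_left ?_ (abs_nonneg _))
  calc ∏ σ ∈ s.erase 1, |-w σ| ≤ ∏ _σ ∈ s.erase 1, X :=
        Finset.prod_le_prod (fun _ _ => abs_nonneg _) fun σ _ => by rw [abs_neg]; exact hwX σ
    _ = X ^ (s.erase 1).card := Finset.prod_const _
    _ ≤ X ^ 5 := by
        refine pow_le_pow_right₀ hX ?_
        rw [Finset.card_erase_of_mem h1s]
        have : s.card ≤ 6 := s.card_le_univ.trans (by simp [Fintype.card_perm, Nat.factorial])
        omega

theorem det_mem_conjRing {lam : Fin 3 → ℝ} {N : ℕ}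
    {A : Fin N → Fin N → Equiv.Perm (Fin 3) → ℝ} (hA : ∀ i j, A i j ∈ conjRing lam) :
    (fun σ => (Matrix.of fun i j => A i j σ).det) ∈ conjRing lam := by
  have h : (fun σ => (Matrix.of fun i j => A i j σ).det) =
      ∑ τ : Equiv.Perm (Fin N), (((Equiv.Perm.sign τ : ℤˣ) : ℤ) : Equiv.Perm (Fin 3) → ℝ) *
        ∏ i, A (τ i) i := by
    funext σ
    simp [Matrix.det_apply', Finset.sum_apply, Finset.prod_apply]
  rw [h]
  exact sum_mem fun τ _ => mul_mem (intCast_mem _ _) (prod_mem fun i _ => hA _ _)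

theorem abs_det_le_factorial_mul_pow {N : ℕ} {M : Matrix (Fin N) (Fin N) ℝ} {B : ℝ}
    (hM : ∀ i j, |M i j| ≤ B) : |M.det| ≤ N.factorial * B ^ N := by
  have h := Matrix.det_le (abv := IsAbsoluteValue.toAbsoluteValue (abs : ℝ → ℝ)) hM
  simpa using h

set_option maxHeartbeats 1000000 in
/-- Interpolation determinants: if two quantities of logarithms `log m` and `log (num / den)` are
very close to being proportional with ratio `r`, then the heights cannot be small. -/
theorem interpolation_determinant_bound {lam : Fin 3 → ℝ}
    (hlam : ∀ i : Fin 3, ∃ z : ℤ, (z : ℝ) =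
      MvPolynomial.aeval lam (MvPolynomial.esymm (Fin 3) ℤ (i + 1)))
    {μ num den : Equiv.Perm (Fin 3) → ℝ} (hμ : μ ∈ conjRing lam) (hnum : num ∈ conjRing lam)
    (hden : den ∈ conjRing lam) (hμ0 : 0 < μ 1) (hμ1 : μ 1 ≠ 1) (hnum0 : 0 < num 1)
    (hden0 : 0 < den 1) {a G : ℝ} (ha : 0 ≤ a) (hG : 0 ≤ G) (hμa : ∀ σ, |μ σ| ≤ exp a)
    (hnumG : ∀ σ, |num σ| ≤ exp G) (hdenG : ∀ σ, |den σ| ≤ exp G)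
    {K L S U r : ℕ} (hK : 0 < K) (hL : 0 < L) (hU : 0 < U) (hS : S + L ≤ r)
    (hKL : K * L ≤ S * U) {E : ℝ} (hE : 1 ≤ E) {R Λ : ℝ} (hR : R = 2 * r * U)
    (hΛ : log (num 1 / den 1) = r * log (μ 1) + Λ) (hNR : ((K * L : ℕ) : ℝ) ≤ 2 * (E * R))
    (hsmall : 2 * (L * U * |Λ|) * (K * L : ℕ) *
      (exp 1 * (2 * (E * R)) / (K * L : ℕ)) ^ (K * L) ≤ 1) :
    ((K * L : ℕ) - 1) / 2 * log E ≤ 6 * log (K * L : ℕ) + log 2 +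
      6 * (K * log (exp 1 * (R + E * R + K) / K)) + L * |log (μ 1)| * (R + E * R) +
      5 * (a * (L * (S + L))) + 6 * (G * (L * U)) := by
  classical
  set N := K * L with hN
  have hNpos : 0 < N := Nat.mul_pos hK hL
  have hrpos : 0 < r := by omega
  have hRpos : 0 < R := by rw [hR]; positivity
  set m := μ 1 with hm
  set γ := num 1 / den 1 with hγ
  have hγ0 : 0 < γ := div_pos hnum0 hden0
  set e : Fin N ≃ Fin K × Fin L := finProdFinEquiv.symm with he
  set zz : Fin (S + L - 1) × Fin U → ℕ := fun q => q.1 + r * q.2 with hzz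
  have hzzinj : Function.Injective zz := by
    rintro ⟨s, u⟩ ⟨s', u'⟩ h
    have h1 : (s : ℕ) + r * u = s' + r * u' := h
    have hs : (s : ℕ) < r := by have := s.2; omega
    have hs' : (s' : ℕ) < r := by have := s'.2; omega
    have h2 : (s : ℕ) = s' := by
      have := congrArg (· % r) h1
      simpa [Nat.add_mul_mod_self_left, Nat.mod_eq_of_lt hs, Nat.mod_eq_of_lt hs'] using this
    have h3 : (u : ℕ) = u' := by
      rw [h2] at h1
      exact Nat.eq_of_mul_eq_mul_left hrpos (Nat.add_left_cancel h1)
    exact Prod.ext (Fin.ext h2) (Fin.ext h3)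
  set F : Matrix (Fin N) (Fin (S + L - 1) × Fin U) ℝ := Matrix.of fun i q =>
    realChoose (zz q : ℝ) (e i).1 * m ^ (((e i).2 : ℕ) * q.1) * γ ^ (((e i).2 : ℕ) * q.2) with hF
  obtain ⟨g, hg⟩ := exists_submatrix_det_ne_zero F (by
    intro p hp
    have h := eq_zero_of_forall_sum_realChoose_eq_zero hμ0 hμ1 hγ0.ne' (by omega : S ≤ r) hKL
      (fun k l => p (e.symm (k, l))) (by
        intro s hs u hu
        rw [← hp (⟨s, hs⟩, ⟨u, hu⟩), ← Equiv.sum_comp e.symm, Fintype.sum_prod_type]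
        simp [hF, hzz])
    funext i
    simpa using congrFun (congrFun h (e i).1) (e i).2)
  have hginj : Function.Injective g := by
    intro p q hpq
    by_contra hne
    exact hg (Matrix.det_zero_of_column_eq hne fun i => by simp [hpq])
  set z : Fin N → ℕ := fun p => zz (g p) with hz
  have hzinj : Function.Injective z := hzzinj.comp hginj
  set M := F.submatrix id g with hM
  have hzR : ∀ p, (z p : ℝ) ≤ R := by
    intro p
    have h1 := (g p).1.2
    have h2 : ((g p).2 : ℕ) + 1 ≤ U := (g p).2.2
    have h3 : z p ≤ 2 * r * U := by
      have : r * (((g p).2 : ℕ) + 1) ≤ r * U := Nat.mul_le_mul_left _ h2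
      have h4 : z p = (g p).1 + r * (g p).2 := rfl
      rw [mul_add] at this
      rw [mul_assoc, h4]
      omega
    rw [hR]
    exact_mod_cast h3
  have hzX : ∀ p, |(z p : ℝ)| ≤ R + E * R := fun p => by
    rw [Nat.abs_cast]
    have := hzR p
    have : 0 ≤ E * R := by positivity
    linarith
  set Q := exp 1 * (R + E * R + K) / K with hQ
  have hK' : (0 : ℝ) < K := by exact_mod_cast hK
  have hQ0 : 0 < Q := by positivity
  set B := Q ^ K * exp (L * |log m| * (R + E * R)) with hB
  have hB0 : 0 < B := by positivity
  set f : Fin N → ℝ → ℝ := fun i x =>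
    realChoose x (e i).1 * exp ((((e i).2 : ℕ) * log m) * x) with hf
  have hfB : ∀ i, HasMajorant (f i) (R + E * R) B := by
    intro i
    refine (hasMajorant_realChoose_mul_exp _ (by positivity) (e i).1.2).mono ?_
    rw [hB, abs_mul, Nat.abs_cast]
    have : (((e i).2 : ℕ) : ℝ) ≤ L := by exact_mod_cast (e i).2.2.le
    gcongr
  have hNpos' : (1 : ℝ) ≤ N := by exact_mod_cast hNpos
  have hbase : 1 ≤ exp 1 * (2 * (E * R)) / N := by
    rw [one_le_div (by linarith)]
    have := Real.add_one_le_exp 1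
    nlinarith
  have hΛs : L * U * |Λ| ≤ 1 / 2 := by
    have h1 : 1 ≤ (N : ℝ) * (exp 1 * (2 * (E * R)) / N) ^ N :=
      one_le_mul_of_one_le_of_one_le hNpos' (one_le_pow₀ hbase)
    have h2 : 0 ≤ L * U * |Λ| := by positivity
    nlinarith
  have hγpow : ∀ k : ℕ, γ ^ k = exp (k * (r * log m + Λ)) := fun k => by
    rw [← hΛ, ← Real.log_pow, Real.exp_log (by positivity)]
  have hmpow : ∀ k : ℕ, m ^ k = exp (k * log m) := fun k => by
    rw [← Real.log_pow, Real.exp_log (by positivity)]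
  have hMf : ∀ i p, |M i p - f i (z p)| ≤ 2 * (L * U * |Λ|) * B := by
    intro i p
    have h1 : M i p = f i (z p) * exp (((e i).2 : ℕ) * (g p).2 * Λ) := by
      simp only [hM, hF, hf, hz, hzz, Matrix.submatrix_apply, Matrix.of_apply, id]
      rw [hγpow, hmpow, mul_assoc, mul_assoc, ← Real.exp_add, ← Real.exp_add]
      push_cast
      ring_nf
    have h2 : (((e i).2 : ℕ) : ℝ) ≤ L := by exact_mod_cast (e i).2.2.le
    have h3 : (((g p).2 : ℕ) : ℝ) ≤ U := by exact_mod_cast (g p).2.2.le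
    have h4 : |(((e i).2 : ℕ) : ℝ) * ((g p).2 : ℕ) * Λ| ≤ L * U * |Λ| := by
      rw [abs_mul, abs_mul, Nat.abs_cast, Nat.abs_cast]
      gcongr
    have h5 := Real.abs_exp_sub_one_le (h4.trans (by linarith))
    rw [h1, ← mul_sub_one, abs_mul, mul_comm]
    exact mul_le_mul (h5.trans (by linarith)) ((hfB i).abs_le (hzX p)) (abs_nonneg _)
      (by positivity)
  have hupper := abs_det_le_of_hasMajorant hNpos hzinj hRpos (by linarith : 0 < E) hzR hfB hMf hNR
    (by
      have := mul_le_mul_of_nonneg_left hsmall hB0.le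
      linarith)
  set w : Equiv.Perm (Fin 3) → ℝ := fun σ => (Matrix.of fun i p : Fin N =>
    (((z p).choose (e i).1 : ℕ) : ℝ) * μ σ ^ (((e i).2 : ℕ) * (g p).1) *
      num σ ^ (((e i).2 : ℕ) * (g p).2) * den σ ^ ((L - 1 - (e i).2) * (g p).2)).det with hw
  have hwmem : w ∈ conjRing lam := by
    refine det_mem_conjRing (A := fun i p => (((z p).choose (e i).1 : ℕ) : _ → ℝ) *
      μ ^ (((e i).2 : ℕ) * (g p).1) * num ^ (((e i).2 : ℕ) * (g p).2) *
        den ^ ((L - 1 - (e i).2) * (g p).2)) fun i p => ?_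
    exact mul_mem (mul_mem (mul_mem (natCast_mem _ _) (pow_mem hμ _)) (pow_mem hnum _))
      (pow_mem hden _)
  have hw1 : w 1 = (∏ p, den 1 ^ ((L - 1) * (g p).2)) * M.det := by
    rw [← Matrix.det_mul_row]
    simp only [hw]
    congr 1
    ext i p
    have h1 : (L - 1) * ((g p).2 : ℕ) =
        ((e i).2 : ℕ) * (g p).2 + (L - 1 - (e i).2) * (g p).2 := by
      rw [← add_mul]
      congr 1
      have := (e i).2.2
      omega
    simp only [Matrix.of_apply, hM, hF, Matrix.submatrix_apply, id, realChoose_natCast]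
    rw [h1, pow_add, hγ, div_pow]
    field_simp
    rfl
  have hw1ne : w 1 ≠ 0 := by
    rw [hw1]
    exact mul_ne_zero (Finset.prod_ne_zero_iff.2 fun p _ => by positivity) hg
  set Bc := Q ^ K * exp (a * (L * (S + L)) + G * (L * U)) with hBc
  have hQ1 : 1 ≤ Q := by
    rw [hQ, one_le_div hK']
    have := Real.add_one_le_exp 1
    have : 0 ≤ R + E * R := by positivity
    nlinarith
  have hBc1 : 1 ≤ Bc := one_le_mul_of_one_le_of_one_le (one_le_pow₀ hQ1)
    (Real.one_le_exp (by positivity))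
  have hwB : ∀ σ, |w σ| ≤ N.factorial * Bc ^ N := by
    intro σ
    refine abs_det_le_factorial_mul_pow fun i p => ?_
    have hl : ((e i).2 : ℕ) < L := (e i).2.2
    have hs : ((g p).1 : ℕ) < S + L := (g p).1.2.trans_le (by omega)
    have hu : ((g p).2 : ℕ) < U := (g p).2.2
    have h0 : (((z p).choose (e i).1 : ℕ) : ℝ) ≤ Q ^ K := by
      have := (hasMajorant_realChoose_mul_exp 0 (by positivity : 0 ≤ R + E * R)
        (e i).1.2).abs_le (hzX p)
      simpa [realChoose_natCast] using this
    have h1 : |μ σ| ^ (((e i).2 : ℕ) * (g p).1) ≤ exp (a * (L * (S + L))) := by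
      calc _ ≤ exp a ^ (((e i).2 : ℕ) * (g p).1) := by gcongr; exact hμa σ
        _ ≤ exp a ^ (L * (S + L)) :=
            pow_le_pow_right₀ (Real.one_le_exp ha) (Nat.mul_le_mul hl.le hs.le)
        _ = _ := by rw [← Real.exp_nat_mul]; push_cast; ring_nf
    have h2 : |num σ| ^ (((e i).2 : ℕ) * (g p).2) * |den σ| ^ ((L - 1 - (e i).2) * (g p).2)
        ≤ exp (G * (L * U)) := by
      calc _ ≤ exp G ^ (((e i).2 : ℕ) * (g p).2) * exp G ^ ((L - 1 - (e i).2) * (g p).2) := by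
            gcongr
            · exact hnumG σ
            · exact hdenG σ
        _ ≤ exp G ^ (L * U) := by
            rw [← pow_add, ← add_mul]
            exact pow_le_pow_right₀ (Real.one_le_exp hG) (Nat.mul_le_mul (by omega) hu.le)
        _ = _ := by rw [← Real.exp_nat_mul]; push_cast; ring_nf
    simp only [Matrix.of_apply]
    rw [abs_mul, abs_mul, abs_mul, Nat.abs_cast, abs_pow, abs_pow, abs_pow, mul_assoc, hBc,
      Real.exp_add, mul_assoc]
    gcongr
  have hfac1 : (1 : ℝ) ≤ N.factorial := by exact_mod_cast N.factorial_pos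
  have hlower := one_le_abs_mul_pow_of_mem_conjRing hlam hwmem hw1ne
    (one_le_mul_of_one_le_of_one_le hfac1 (one_le_pow₀ hBc1)) hwB
  have hprod : |∏ p, den 1 ^ ((L - 1) * ((g p).2 : ℕ))| ≤ exp (G * (L * U)) ^ N := by
    rw [Finset.abs_prod]
    calc _ ≤ ∏ _p : Fin N, exp (G * (L * U)) := by
          refine Finset.prod_le_prod (fun _ _ => abs_nonneg _) fun p _ => ?_
          rw [abs_pow]
          calc _ ≤ exp G ^ ((L - 1) * ((g p).2 : ℕ)) := by gcongr; exact hdenG 1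
            _ ≤ exp G ^ (L * U) := pow_le_pow_right₀ (Real.one_le_exp hG)
                (Nat.mul_le_mul (by omega) (g p).2.2.le)
            _ = _ := by rw [← Real.exp_nat_mul]; push_cast; ring_nf
      _ = _ := by simp
  have hfac : (N.factorial : ℝ) ≤ (N : ℝ) ^ N := by exact_mod_cast N.factorial_le_pow
  have hmain : E ^ (∑ j : Fin N, (j : ℕ)) ≤
      ((N : ℝ) ^ 6 * 2 * B * exp (G * (L * U)) * Bc ^ 5) ^ N := by
    calc E ^ (∑ j : Fin N, (j : ℕ))
        ≤ E ^ (∑ j : Fin N, (j : ℕ)) * (|w 1| * (N.factorial * Bc ^ N) ^ 5) :=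
          le_mul_of_one_le_right (by positivity) hlower
      _ = (|M.det| * E ^ (∑ j : Fin N, (j : ℕ))) *
          |∏ p, den 1 ^ ((L - 1) * ((g p).2 : ℕ))| * (N.factorial * Bc ^ N) ^ 5 := by
          rw [hw1, abs_mul]; ring
      _ ≤ (N.factorial * (2 * B) ^ N) * exp (G * (L * U)) ^ N * (N.factorial * Bc ^ N) ^ 5 := by
          gcongr
      _ ≤ ((N : ℝ) ^ N * (2 * B) ^ N) * exp (G * (L * U)) ^ N * ((N : ℝ) ^ N * Bc ^ N) ^ 5 := by
          gcongr
      _ = _ := by ring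
  have hlog := Real.log_le_log (by positivity) hmain
  have hsum : ((∑ j : Fin N, (j : ℕ) : ℕ) : ℝ) = N * ((N - 1) / 2) := by
    have := Finset.sum_range_id_mul_two N
    rw [Fin.sum_univ_eq_sum_range (fun i => i) N]
    have h2 : (((∑ i ∈ Finset.range N, i) * 2 : ℕ) : ℝ) = ((N * (N - 1) : ℕ) : ℝ) := by rw [this]
    rw [Nat.cast_mul, Nat.cast_mul, Nat.cast_sub hNpos] at h2
    push_cast at h2 ⊢
    linarith
  rw [Real.log_pow, Real.log_pow, hsum, mul_assoc] at hlog
  have hlog2 := le_of_mul_le_mul_left hlog (by linarith : (0:ℝ) < N)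
  have hNne : (N : ℝ) ≠ 0 := by linarith
  have hBcne : Bc ≠ 0 := by linarith
  rw [Real.log_mul (by positivity) (by positivity), Real.log_mul (by positivity) (by positivity),
    Real.log_mul (by positivity) (by positivity), Real.log_mul (by positivity) (by positivity),
    Real.log_pow, Real.log_pow, Real.log_exp, hB, hBc, Real.log_mul (by positivity) (by positivity),
    Real.log_mul (by positivity) (by positivity), Real.log_exp, Real.log_exp, Real.log_pow] at hlog2
  push_cast at hlog2
  linarith

set_option maxHeartbeats 1000000 in
/-- A product of a large power of `μ` with bounded conjugates cannot be too close to a quotient of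
small height. -/
theorem false_of_abs_log_sub_small {lam : Fin 3 → ℝ}
    (hlam : ∀ i : Fin 3, ∃ z : ℤ, (z : ℝ) =
      MvPolynomial.aeval lam (MvPolynomial.esymm (Fin 3) ℤ (i + 1)))
    {μ num den : Equiv.Perm (Fin 3) → ℝ} (hμ : μ ∈ conjRing lam) (hnum : num ∈ conjRing lam)
    (hden : den ∈ conjRing lam) (hμ0 : 0 < μ 1) {n t r : ℕ} (hn : 1 ≤ n) (ht : 1 ≤ t)
    (hr : 10 ^ 20 ≤ r) (hμa : ∀ σ, |μ σ| ≤ exp (6 * (t * n)))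
    (hnumG : ∀ σ, |num σ| ≤ exp (5 * r / 10 ^ 14))
    (hdenG : ∀ σ, |den σ| ≤ exp (5 * r / 10 ^ 14))
    (hnum0 : exp (-(5 * r / 10 ^ 14)) ≤ num 1) (hden0 : exp (-(5 * r / 10 ^ 14)) ≤ den 1)
    {Λ : ℝ} (hΛ0 : Λ ≠ 0) (hΛ : log (num 1 / den 1) = r * log (μ 1) + Λ)
    (hsmall : |Λ| ≤ exp (-(27 / 1000 * (r * (t * n))))) : False := by
  set G : ℝ := 5 * r / 10 ^ 14 with hG
  have hr' : (10 : ℝ) ^ 20 ≤ r := by exact_mod_cast hr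
  have hn' : (1 : ℝ) ≤ n := by exact_mod_cast hn
  have ht' : (1 : ℝ) ≤ t := by exact_mod_cast ht
  set τ : ℝ := t * n with hτ
  have hτ1 : 1 ≤ τ := one_le_mul_of_one_le_of_one_le ht' hn'
  have hrτ : (r : ℝ) ≤ r * τ := le_mul_of_one_le_right (by linarith) hτ1
  have hG0 : 0 ≤ G := by positivity
  have hnumpos : 0 < num 1 := (exp_pos _).trans_le hnum0
  have hdenpos : 0 < den 1 := (exp_pos _).trans_le hden0
  have hΛ1 : |Λ| ≤ 1 := hsmall.trans (Real.exp_le_one_iff.2 (by linarith))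
  by_cases hμ1 : μ 1 = 1
  · rw [hμ1, Real.log_one, mul_zero, zero_add] at hΛ
    have h1 : num 1 - den 1 = den 1 * (exp Λ - 1) := by
      rw [← hΛ, Real.exp_log (by positivity)]
      field_simp
    have hmem := sub_mem hnum hden
    have hne : (num - den) 1 ≠ 0 := by
      rw [Pi.sub_apply, h1]
      refine mul_ne_zero hdenpos.ne' (sub_ne_zero.2 fun h => hΛ0 ?_)
      exact Real.exp_eq_one_iff _ |>.1 h
    have h2 := one_le_abs_mul_pow_of_mem_conjRing hlam hmem hne (X := 2 * exp G)
      (by have := Real.one_le_exp hG0; linarith) (fun σ => by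
        rw [Pi.sub_apply]
        have := abs_sub (num σ) (den σ)
        have := hnumG σ
        have := hdenG σ
        linarith)
    rw [Pi.sub_apply, h1, abs_mul] at h2
    have h3 := Real.abs_exp_sub_one_le hΛ1
    have h4 : |den 1| * |exp Λ - 1| * (2 * exp G) ^ 5 ≤
        exp G * (2 * exp (-(27 / 1000 * (r * τ)))) * (2 * exp G) ^ 5 := by
      gcongr
      · exact hdenG 1
      · linarith
    have h5 : exp G * (2 * exp (-(27 / 1000 * (r * τ)))) * (2 * exp G) ^ 5 =
        64 * exp (6 * G - 27 / 1000 * (r * τ)) := by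
      rw [sub_eq_add_neg, Real.exp_add, show 6 * G = (6 : ℕ) * G by norm_num, Real.exp_nat_mul]
      ring
    have h6 : exp (6 * G - 27 / 1000 * (r * τ)) ≤ exp (-(100 : ℕ) * 1) := by
      refine Real.exp_le_exp.2 ?_
      rw [hG]
      push_cast
      linarith
    rw [neg_mul, Real.exp_neg, Real.exp_nat_mul] at h6
    have h7 : (2 : ℝ) ^ 100 ≤ exp 1 ^ 100 := by
      have := Real.add_one_le_exp 1
      gcongr
      linarith
    have h8 : (exp 1 ^ 100)⁻¹ ≤ ((2 : ℝ) ^ 100)⁻¹ := by gcongr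
    have h9 : 64 * ((2 : ℝ) ^ 100)⁻¹ < 1 := by norm_num
    linarith
  · obtain ⟨S, hS⟩ : ∃ S : ℕ, S = r / 10 ^ 8 + 1 := ⟨_, rfl⟩
    have hS1 : (r : ℝ) ≤ 10 ^ 8 * S := by
      have : r ≤ 10 ^ 8 * S := by omega
      exact_mod_cast this
    have hS2 : (10 : ℝ) ^ 8 * S ≤ r + 10 ^ 8 := by
      have : 10 ^ 8 * S ≤ r + 10 ^ 8 := by omega
      exact_mod_cast this
    have hSpos : 0 < S := by omega
    have htn : 0 < t * n := Nat.mul_pos ht hn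
    have hlogm : |log (μ 1)| ≤ 11 / 10 ^ 14 := by
      have h1 : |log (num 1 / den 1)| ≤ 2 * G := by
        rw [Real.log_div hnumpos.ne' hdenpos.ne']
        have h1 : -G ≤ log (num 1) := (Real.le_log_iff_exp_le hnumpos).2 hnum0
        have h2 : -G ≤ log (den 1) := (Real.le_log_iff_exp_le hdenpos).2 hden0
        have h3 : log (num 1) ≤ G := (Real.log_le_iff_le_exp hnumpos).2
          ((le_abs_self _).trans (hnumG 1))
        have h4 : log (den 1) ≤ G := (Real.log_le_iff_le_exp hdenpos).2
          ((le_abs_self _).trans (hdenG 1))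
        rw [abs_le]; constructor <;> linarith
      have h2 : r * |log (μ 1)| ≤ 2 * G + 1 := by
        rw [show (r : ℝ) * |log (μ 1)| = |r * log (μ 1)| by rw [abs_mul, Nat.abs_cast],
          eq_sub_of_add_eq hΛ.symm]
        exact (abs_sub _ _).trans (by linarith)
      have h3 : r * |log (μ 1)| ≤ r * (11 / 10 ^ 14) := h2.trans (by rw [hG]; linarith)
      exact le_of_mul_le_mul_left h3 (by linarith)
    obtain ⟨N, hN⟩ : ∃ N : ℝ, N = 10 ^ 5 * (S * τ) := ⟨_, rfl⟩
    have hKL : (((S * (200 * (t * n))) * 500 : ℕ) : ℝ) = N := by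
      rw [hN, hτ]; push_cast; ring
    have hK : ((S * (200 * (t * n)) : ℕ) : ℝ) = N / 500 := by
      rw [hN, hτ]; push_cast; ring
    have hU : ((500 * (200 * (t * n)) : ℕ) : ℝ) = 10 ^ 5 * τ := by
      rw [hτ]; push_cast; ring
    have hS1τ := mul_le_mul_of_nonneg_right hS1 (by linarith : 0 ≤ τ)
    have hS2τ := mul_le_mul_of_nonneg_right hS2 (by linarith : 0 ≤ τ)
    have hr'τ := mul_le_mul_of_nonneg_right hr' (by linarith : 0 ≤ τ)
    have hN1 : r * τ ≤ 10 ^ 3 * N := by rw [hN]; linarith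
    have hN2 : 10 ^ 3 * N ≤ 1.01 * (r * τ) := by rw [hN]; linarith
    have hN3 : 10 ^ 17 ≤ N := by linarith
    have hτN : τ ≤ N := by
      have : (1 : ℝ) ≤ S := by exact_mod_cast hSpos
      have := le_mul_of_one_le_left (by linarith : 0 ≤ τ) this
      rw [hN]; linarith
    have hexp1 : exp 1 ≤ 2.7183 := by have := Real.exp_one_lt_d9; linarith
    have hexp1' : 2.7 ≤ exp 1 := by have := Real.exp_one_gt_d9; linarith
    have hR : ((2 : ℝ) * r * (500 * (200 * (t * n)) : ℕ)) = 2 * 10 ^ 5 * (r * τ) := by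
      rw [hU]; ring
    have key := interpolation_determinant_bound hlam hμ hnum hden hμ0 hμ1 hnumpos hdenpos
      (a := 6 * τ) (G := G) (by positivity) hG0 hμa hnumG hdenG
      (K := S * (200 * (t * n))) (L := 500) (S := S) (U := 500 * (200 * (t * n))) (r := r)
      (by positivity) (by norm_num) (by positivity) (by omega) (by ring_nf; exact le_rfl)
      (E := 50) (by norm_num) hR.symm hΛ (by rw [hKL]; linarith) (by
        rw [hKL, hU]
        have h1 : exp 1 * (2 * (50 * (2 * 10 ^ 5 * (r * τ)))) / N ≤ exp 1 ^ 25 := by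
          have h2 : (2.7 : ℝ) ^ 25 ≤ exp 1 ^ 25 := by gcongr
          refine le_trans ?_ h2
          rw [div_le_iff₀ (by linarith)]
          have h3 : exp 1 * (2 * (50 * (2 * 10 ^ 5 * (r * τ)))) ≤
              2.7183 * (2 * (50 * (2 * 10 ^ 5 * (10 ^ 3 * N)))) := by gcongr
          refine h3.trans ?_
          norm_num
          linarith
        have h2 : (exp 1 * (2 * (50 * (2 * 10 ^ 5 * (r * τ)))) / N) ^
            ((S * (200 * (t * n))) * 500) ≤ exp (25 * N) := by
          refine (pow_le_pow_left₀ (by positivity) h1 _).trans_eq ?_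
          rw [← pow_mul, ← Real.exp_nat_mul, Nat.cast_mul, hKL]
          norm_num
        have h3 : 2 * ((500 : ℕ) * (10 ^ 5 * τ)) * N ≤ exp N := by
          have h4 := Real.pow_div_factorial_le_exp N (by linarith) 3
          have h5 : 2 * ((500 : ℕ) * (10 ^ 5 * τ)) * N ≤ 2 * (500 * (10 ^ 5 * N)) * N := by
            push_cast
            gcongr
          refine h5.trans (le_trans ?_ h4)
          rw [le_div_iff₀ (by positivity)]
          norm_num [Nat.factorial]
          have h6 := mul_le_mul_of_nonneg_left hN3 (mul_self_nonneg N)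
          have h7 := mul_self_nonneg N
          linarith
        calc _ = (2 * ((500 : ℕ) * (10 ^ 5 * τ)) * N) * |Λ| *
            (exp 1 * (2 * (50 * (2 * 10 ^ 5 * (r * τ)))) / N) ^
              ((S * (200 * (t * n))) * 500) := by ring
          _ ≤ exp N * exp (-(27 / 1000 * (r * τ))) * exp (25 * N) := by gcongr
          _ = exp (26 * N - 27 / 1000 * (r * τ)) := by
            rw [← Real.exp_add, ← Real.exp_add]; ring_nf
          _ ≤ 1 := Real.exp_le_one_iff.2 (by linarith))
    rw [hKL, hK, hU] at key
    have hlogP : log (exp 1 * (2 * 10 ^ 5 * (r * τ) + 50 * (2 * 10 ^ 5 * (r * τ)) + N / 500) /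
        (N / 500)) ≤ 31 := by
      rw [Real.log_le_iff_le_exp (by positivity), div_le_iff₀ (by linarith)]
      have h1 : exp 31 = exp 1 ^ 31 := by rw [← Real.exp_nat_mul]; norm_num
      have h2 : (2.7 : ℝ) ^ 31 ≤ exp 1 ^ 31 := by gcongr
      rw [h1]
      have h3 : exp 1 * (2 * 10 ^ 5 * (r * τ) + 50 * (2 * 10 ^ 5 * (r * τ)) + N / 500) ≤
          2.7183 * (2 * 10 ^ 5 * (10 ^ 3 * N) + 50 * (2 * 10 ^ 5 * (10 ^ 3 * N)) + N / 500) := by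
        gcongr
      refine h3.trans (le_trans ?_ (mul_le_mul_of_nonneg_right h2 (by linarith)))
      norm_num
      linarith
    have hlogN : log N ≤ N / 1000 + 1000 := by
      have h1 := Real.log_le_sub_one_of_pos (by linarith : 0 < N / 1000)
      have h2 := Real.log_le_sub_one_of_pos (by norm_num : (0:ℝ) < 1000)
      rw [Real.log_div (by linarith) (by norm_num)] at h1
      linarith
    have hlog2 : log 2 ≤ 1 := by
      have := Real.log_le_sub_one_of_pos (by norm_num : (0:ℝ) < 2)
      linarith
    have hlog50 : 3.5 ≤ log 50 := by
      rw [Real.le_log_iff_exp_le (by norm_num)]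
      have h1 : exp 3.5 = exp 1 ^ 3 * exp (1 / 2) := by
        rw [← Real.exp_nat_mul, ← Real.exp_add]; norm_num
      have h2 : exp (1 / 2) ^ 2 = exp 1 := by rw [← Real.exp_nat_mul]; norm_num
      have h3 : exp (1 / 2) ≤ 1.65 := by
        by_contra h
        have h5 := pow_lt_pow_left₀ (not_le.1 h) (by norm_num) two_ne_zero
        norm_num at h5
        linarith
      have h4 : exp 1 ^ 3 ≤ 2.7183 ^ 3 := by gcongr
      rw [h1]
      exact (mul_le_mul h4 h3 (exp_pos _).le (by norm_num)).trans (by norm_num)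
    have e1 : (N - 1) / 2 * 3.5 ≤ (N - 1) / 2 * log 50 := by
      gcongr
      linarith
    have e2 : N / 500 * log (exp 1 * (2 * 10 ^ 5 * (r * τ) + 50 * (2 * 10 ^ 5 * (r * τ)) +
        N / 500) / (N / 500)) ≤ N / 500 * 31 := by gcongr
    have e3 : (500 : ℕ) * |log (μ 1)| * (2 * 10 ^ 5 * (r * τ) + 50 * (2 * 10 ^ 5 * (r * τ))) ≤
        (500 : ℕ) * (11 / 10 ^ 14) * (2 * 10 ^ 5 * (10 ^ 3 * N) +
          50 * (2 * 10 ^ 5 * (10 ^ 3 * N))) := by gcongr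
    have e4 : 6 * τ * ((500 : ℕ) * (S + (500 : ℕ))) ≤ 4 / 100 * N := by
      rw [hN]; push_cast; linarith
    have e5 : G * ((500 : ℕ) * (10 ^ 5 * τ)) = 5 * (500 * (10 ^ 5 * (r * τ))) / 10 ^ 14 := by
      rw [hG]; push_cast; ring
    push_cast at key e3 e4 e5
    linarith

/-- `v` is a vector of conjugates of a unit of the ring generated by the `lam i`. -/
def IsConjUnit (lam v : Fin 3 → ℝ) : Prop :=
  ∀ i, v i ≠ 0 ∧ (fun σ : Equiv.Perm (Fin 3) => v (σ i)) ∈ conjRing lam ∧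
    (fun σ : Equiv.Perm (Fin 3) => (v (σ i))⁻¹) ∈ conjRing lam

theorem IsConjUnit.mul {lam v w : Fin 3 → ℝ} (hv : IsConjUnit lam v) (hw : IsConjUnit lam w) :
    IsConjUnit lam fun i => v i * w i := fun i => by
  refine ⟨mul_ne_zero (hv i).1 (hw i).1, mul_mem (hv i).2.1 (hw i).2.1, ?_⟩
  simp only [mul_inv]
  exact mul_mem (hv i).2.2 (hw i).2.2

theorem IsConjUnit.inv {lam v : Fin 3 → ℝ} (hv : IsConjUnit lam v) :
    IsConjUnit lam fun i => (v i)⁻¹ := fun i => by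
  refine ⟨inv_ne_zero (hv i).1, (hv i).2.2, ?_⟩
  simp only [inv_inv]
  exact (hv i).2.1

theorem IsConjUnit.zpow {lam v : Fin 3 → ℝ} (hv : IsConjUnit lam v) (z : ℤ) :
    IsConjUnit lam fun i => v i ^ z := by
  have key : ∀ {w : Fin 3 → ℝ}, IsConjUnit lam w → ∀ k : ℕ, IsConjUnit lam fun i => w i ^ k := by
    intro w hw k i
    refine ⟨pow_ne_zero _ (hw i).1, pow_mem (hw i).2.1 k, ?_⟩
    simp only [← inv_pow]
    exact pow_mem (hw i).2.2 k
  obtain ⟨k, rfl | rfl⟩ := z.eq_nat_or_neg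
  · simpa using key hv k
  · simpa using key hv.inv k

theorem exists_abs_mem_conjRing {lam : Fin 3 → ℝ} {w : Equiv.Perm (Fin 3) → ℝ}
    (hw : w ∈ conjRing lam) : ∃ w' ∈ conjRing lam, w' 1 = |w 1| ∧ ∀ σ, |w' σ| = |w σ| := by
  rcases abs_cases (w 1) with h | h
  · exact ⟨w, hw, h.1.symm, fun _ => rfl⟩
  · exact ⟨-w, neg_mem hw, h.1.symm, fun _ => abs_neg _⟩

theorem abs_log_le_two_mul_abs_sub_one {x : ℝ} (hx : |x - 1| ≤ 1 / 2) :
    |log x| ≤ 2 * |x - 1| := by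
  have h1 := abs_le.1 hx
  have hx0 : 1 / 2 ≤ x := by linarith
  rw [abs_le]
  constructor
  · have h2 := Real.one_sub_inv_le_log_of_pos (by linarith : 0 < x)
    refine le_trans ?_ h2
    have h3 : 1 - x⁻¹ = (x - 1) / x := by field_simp
    rw [h3, le_div_iff₀ (by linarith)]
    rcases abs_cases (x - 1) with h | h <;> nlinarith
  · have h2 := Real.log_le_sub_one_of_pos (by linarith : 0 < x)
    have := le_abs_self (x - 1)
    have := abs_nonneg (x - 1)
    linarith

theorem abs_mem_exp_of_abs_log_le {x c : ℝ} (hx : x ≠ 0) (h : |log (|x|)| ≤ c) :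
    exp (-c) ≤ |x| ∧ |x| ≤ exp c := by
  have h1 := abs_le.1 h
  exact ⟨(Real.le_log_iff_exp_le (abs_pos.2 hx)).1 h1.1,
    (Real.log_le_iff_le_exp (abs_pos.2 hx)).1 h1.2⟩

set_option maxHeartbeats 1000000 in
/-- A unit `ε` of rank two whose exponents `u`, `v` are large cannot have `ε 0` extremely small in
a unit equation. -/
theorem false_of_siegel_identity {lam A C ε : Fin 3 → ℝ}
    (hlam : ∀ i : Fin 3, ∃ z : ℤ, (z : ℝ) =
      MvPolynomial.aeval lam (MvPolynomial.esymm (Fin 3) ℤ (i + 1)))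
    (hA : IsConjUnit lam A) (hC : IsConjUnit lam C) (hε : IsConjUnit lam ε) {n : ℕ} (hn : 1 ≤ n)
    (hAn : ∀ i, |log (|A i|)| ≤ n) (hCn : ∀ i, |log (|C i|)| ≤ n)
    (hgap : ∀ i j, i ≠ j → |log (|lam i - lam j|)| ≤ n) (hne : Function.Injective lam) {u v : ℝ}
    (hu : 10 ^ 43 * (n : ℝ) ^ 3 ≤ u) (hv : |v| ≤ u)
    (huv : ∀ i, log |ε i| = u * log |A i| + v * log |C i|)
    (hsum : (lam 0 - lam 1) * ε 2 + (lam 1 - lam 2) * ε 0 + (lam 2 - lam 0) * ε 1 = 0)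
    (hsmall : 2 * |(lam 1 - lam 2) * ε 0 / ((lam 0 - lam 1) * ε 2)| ≤
      exp (-(27 / 1000 * (u * n)))) : False := by
  have hn' : (1 : ℝ) ≤ n := by exact_mod_cast hn
  set T : ℕ := 10 ^ 14 * n with hT
  have hTr : (T : ℝ) = 10 ^ 14 * n := by rw [hT]; push_cast; ring
  have hTpos : 0 < T := by positivity
  have hTpos' : (0 : ℝ) < T := by exact_mod_cast hTpos
  have hupos : 0 < u := lt_of_lt_of_le (by positivity) hu
  obtain ⟨q, t', ht'0, ht'T, hq⟩ := Real.exists_int_int_abs_mul_sub_le (v / u) hTpos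
  obtain ⟨t, rfl⟩ := Int.eq_ofNat_of_zero_le ht'0.le
  have ht : 1 ≤ t := by exact_mod_cast ht'0
  have htT : t ≤ T := by exact_mod_cast ht'T
  have ht' : (1 : ℝ) ≤ t := by exact_mod_cast ht
  have htT' : (t : ℝ) ≤ T := by exact_mod_cast htT
  have hq' : |(t : ℝ) * (v / u) - q| ≤ 1 / T := by
    refine le_trans (by exact_mod_cast hq) ?_
    gcongr
    linarith
  have hvu : |v / u| ≤ 1 := by
    rw [abs_div, abs_of_pos hupos]
    exact (div_le_one hupos).2 hv
  have htvu : |(t : ℝ) * (v / u)| ≤ t := by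
    rw [abs_mul, Nat.abs_cast]
    exact mul_le_of_le_one_right (by linarith) hvu
  have hT2 : (2 : ℝ) ≤ T := by rw [hTr]; linarith
  have hqt : |(q : ℝ)| ≤ 2 * t := by
    have h1 : |(q : ℝ)| ≤ t + 1 / T := by
      have : (q : ℝ) = t * (v / u) - (t * (v / u) - q) := by ring
      rw [this]
      exact (abs_sub _ _).trans (add_le_add htvu hq')
    have h2 : 1 / (T : ℝ) ≤ 1 := (div_le_one hTpos').2 (by linarith)
    linarith
  set r : ℕ := ⌊u / t⌋₊ with hr
  have hr1 : (r : ℝ) ≤ u / t := Nat.floor_le (by positivity)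
  have hr2 : u / t < r + 1 := Nat.lt_floor_add_one _
  have hrt : r * t ≤ u := (le_div_iff₀ (by linarith)).1 hr1
  have hrt2 : u < (r + 1) * t := (div_lt_iff₀ (by linarith)).1 hr2
  have hrbig : 2 * (T : ℝ) ^ 2 ≤ r := by
    by_contra h
    rw [not_le] at h
    have h1 : ((r : ℝ) + 1) * t ≤ (2 * (T : ℝ) ^ 2 + 1) * T := by gcongr
    have h2 : (2 * (T : ℝ) ^ 2 + 1) * T ≤ 3 * (T : ℝ) ^ 3 := by nlinarith [sq_nonneg (T : ℝ)]
    have h3 : 3 * (T : ℝ) ^ 3 ≤ 10 ^ 43 * (n : ℝ) ^ 3 := by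
      rw [hTr, mul_pow]
      have : (0 : ℝ) ≤ (n : ℝ) ^ 3 := by positivity
      norm_num
      linarith
    linarith
  have h2tT : 2 * t * T ≤ (r : ℝ) := by nlinarith
  have hrT : (r : ℝ) / T * n = r / 10 ^ 14 := by rw [hTr]; field_simp
  have h2t : 2 * (t : ℝ) ≤ r / T := (le_div_iff₀ hTpos').2 h2tT
  have hnr : (n : ℝ) ≤ r / 10 ^ 14 := by
    rw [← hrT]
    nlinarith
  set M : Fin 3 → ℝ := fun i => A i ^ (t : ℤ) * C i ^ q with hM
  have hMu : IsConjUnit lam M := (hA.zpow t).mul (hC.zpow q)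
  set ρ : Fin 3 → ℝ := fun i => ε i * (M i ^ (r : ℤ))⁻¹ with hρ
  have hρu : IsConjUnit lam ρ := hε.mul (hMu.zpow r).inv
  have hlogM : ∀ i, log |M i| = t * log |A i| + q * log |C i| := by
    intro i
    have h1 := (hA i).1
    have h2 := (hC i).1
    simp only [hM]
    rw [abs_mul, abs_zpow, abs_zpow, Real.log_mul (by positivity) (by positivity), Real.log_zpow,
      Real.log_zpow]
    push_cast
    ring
  have hlogρ : ∀ i, log |ρ i| = log |ε i| - r * log |M i| := by
    intro i
    have h1 := (hε i).1
    have h2 := (hMu i).1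
    simp only [hρ]
    rw [abs_mul, abs_inv, abs_zpow, Real.log_mul (by positivity) (by positivity), Real.log_inv,
      Real.log_zpow]
    push_cast
    ring
  clear_value M ρ r T
  have hMn : ∀ i, |log (|M i|)| ≤ 3 * (t * n) := by
    intro i
    rw [hlogM]
    refine (abs_add_le _ _).trans ?_
    rw [abs_mul, abs_mul, Nat.abs_cast]
    have h1 : (t : ℝ) * |log (|A i|)| ≤ t * n := by gcongr; exact hAn i
    have h2 : |(q : ℝ)| * |log (|C i|)| ≤ 2 * t * n := by gcongr; exact hCn i
    linarith
  have hρn : ∀ i, |log (|ρ i|)| ≤ 2 * (r / 10 ^ 14) := by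
    intro i
    have h1 : log |ρ i| = (u - r * t) * log |A i| +
        ((u / t - r) * (t * (v / u)) + r * (t * (v / u) - q)) * log |C i| := by
      rw [hlogρ, huv, hlogM]
      field_simp
      ring
    have h2 : |u - r * t| ≤ t := by rw [abs_le]; constructor <;> linarith
    have h3 : |(u / t - r) * (t * (v / u)) + r * (t * (v / u) - q)| ≤ t + r / T := by
      refine (abs_add_le _ _).trans ?_
      rw [abs_mul (u / t - r), abs_mul (r : ℝ), Nat.abs_cast]
      have h4 : |u / t - r| ≤ 1 := by rw [abs_le]; constructor <;> linarith
      have h5 : |u / t - r| * |t * (v / u)| ≤ 1 * t := by gcongr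
      have h6 : (r : ℝ) * |t * (v / u) - q| ≤ r * (1 / T) := by gcongr
      rw [mul_one_div] at h6
      linarith
    rw [h1]
    refine (abs_add_le _ _).trans ?_
    rw [abs_mul, abs_mul]
    have h4 : |u - r * t| * |log (|A i|)| ≤ t * n := by gcongr; exact hAn i
    have h5 : |(u / t - r) * (t * (v / u)) + r * (t * (v / u) - q)| * |log (|C i|)| ≤
        (t + r / T) * n := by gcongr; exact hCn i
    have h6 : 2 * (t : ℝ) * n ≤ r / T * n := by gcongr
    linarith
  have hlne : ∀ i j, i ≠ j → lam i - lam j ≠ 0 := fun i j hij =>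
    sub_ne_zero.2 (hne.ne hij)
  obtain ⟨μ, hμ, hμ1, hμσ⟩ := exists_abs_mem_conjRing (mul_mem (hMu 2).2.1 (hMu 1).2.2)
  obtain ⟨den, hden, hden1, hdenσ⟩ := exists_abs_mem_conjRing
    (sub_mem (coord_mem_conjRing lam 0) (coord_mem_conjRing lam 1))
  obtain ⟨num, hnum, hnum1, hnumσ⟩ := exists_abs_mem_conjRing
    (mul_mem (mul_mem (sub_mem (coord_mem_conjRing lam 0) (coord_mem_conjRing lam 2))
      (hρu 1).2.1) (hρu 2).2.2)
  have hμb : ∀ i j, |log (|M i * (M j)⁻¹|)| ≤ 6 * (t * n) := by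
    intro i j
    have h1 := (hMu i).1
    have h2 := (hMu j).1
    rw [abs_mul, abs_inv, Real.log_mul (by positivity) (by positivity), Real.log_inv,
      ← sub_eq_add_neg]
    refine (abs_sub _ _).trans ?_
    have := hMn i
    have := hMn j
    linarith
  have hnumb : ∀ i j k l, i ≠ j → |log (|(lam i - lam j) * ρ k * (ρ l)⁻¹|)| ≤ 5 * r / 10 ^ 14 := by
    intro i j k l hij
    have h1 := (hρu k).1
    have h2 := (hρu l).1
    have h3 := hlne i j hij
    rw [abs_mul, abs_mul, abs_inv, Real.log_mul (by positivity) (by positivity),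
      Real.log_mul (by positivity) (by positivity), Real.log_inv, ← sub_eq_add_neg]
    refine (abs_sub _ _).trans ?_
    have := abs_add_le (log |lam i - lam j|) (log |ρ k|)
    have := hρn k
    have := hρn l
    have := hgap i j hij
    linarith
  have hdenb : ∀ i j, i ≠ j → |log (|lam i - lam j|)| ≤ 5 * r / 10 ^ 14 := by
    intro i j hij
    have := hgap i j hij
    have : (0 : ℝ) ≤ r / 10 ^ 14 := by positivity
    linarith
  have hσ : ∀ (σ : Equiv.Perm (Fin 3)) {i j : Fin 3}, i ≠ j → σ i ≠ σ j :=
    fun σ _ _ h => σ.injective.ne h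
  set κ : ℝ := ((lam 0 - lam 2) * ε 1) / ((lam 0 - lam 1) * ε 2) with hκ
  have hε0 := (hε 0).1
  have hε1 := (hε 1).1
  have hε2 := (hε 2).1
  have h01 := hlne 0 1 (by decide)
  have h02 := hlne 0 2 (by decide)
  have h12 := hlne 1 2 (by decide)
  have hκ1 : κ - 1 = (lam 1 - lam 2) * ε 0 / ((lam 0 - lam 1) * ε 2) := by
    rw [hκ]
    field_simp
    linarith
  have hκne : κ - 1 ≠ 0 := by rw [hκ1]; positivity
  have hκ0 : κ ≠ 0 := by rw [hκ]; positivity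
  rw [← hκ1] at hsmall
  have hκle : |κ - 1| ≤ 1 / 2 := by
    have : exp (-(27 / 1000 * (u * n))) ≤ 1 := Real.exp_le_one_iff.2 (by
      have : 0 ≤ u * n := by positivity
      linarith)
    linarith
  have hlogκ : log κ = log |lam 0 - lam 2| + log |ε 1| - (log |lam 0 - lam 1| + log |ε 2|) := by
    rw [← Real.log_abs κ, hκ, abs_div, abs_mul, abs_mul,
      Real.log_div (by positivity) (by positivity), Real.log_mul (by positivity) (by positivity),
      Real.log_mul (by positivity) (by positivity)]
  have hκpos : 0 < κ := by have := abs_le.1 hκle; linarith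
  refine false_of_abs_log_sub_small hlam hμ hnum hden ?_ hn ht (r := r) ?_ (fun σ => ?_)
    (fun σ => ?_) (fun σ => ?_) ?_ ?_ (Λ := log κ) ?_ ?_ ?_
  · rw [hμ1]
    exact abs_pos.2 (mul_ne_zero (hMu _).1 (inv_ne_zero (hMu _).1))
  · have h1 : (10 : ℝ) ^ 20 ≤ r := by
      refine le_trans ?_ hrbig
      rw [hTr]
      nlinarith
    exact_mod_cast h1
  · rw [hμσ]
    exact (abs_mem_exp_of_abs_log_le (mul_ne_zero (hMu _).1 (inv_ne_zero (hMu _).1))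
      (hμb (σ 2) (σ 1))).2
  · rw [hnumσ]
    exact (abs_mem_exp_of_abs_log_le (mul_ne_zero (mul_ne_zero (hlne _ _ (hσ σ (by decide)))
      (hρu _).1) (inv_ne_zero (hρu _).1))
      (hnumb (σ 0) (σ 2) (σ 1) (σ 2) (hσ σ (by decide)))).2
  · rw [hdenσ]
    exact (abs_mem_exp_of_abs_log_le (hlne _ _ (hσ σ (by decide)))
      (hdenb (σ 0) (σ 1) (hσ σ (by decide)))).2
  · rw [hnum1]
    exact (abs_mem_exp_of_abs_log_le (mul_ne_zero (mul_ne_zero h02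
      (hρu _).1) (inv_ne_zero (hρu _).1)) (hnumb 0 2 1 2 (by decide))).1
  · rw [hden1]
    exact (abs_mem_exp_of_abs_log_le h01 (hdenb 0 1 (by decide))).1
  · intro h
    rcases Real.log_eq_zero.1 h with h | h | h
    · exact hκ0 h
    · exact hκne (by linarith)
    · linarith
  · rw [hnum1, hden1, hμ1, Real.log_div, hlogκ]
    · have e1 : log |(lam 0 - lam 2) * ρ 1 * (ρ 2)⁻¹| =
          log |lam 0 - lam 2| + log |ρ 1| - log |ρ 2| := by
        have h1 := (hρu 1).1
        have h2 := (hρu 2).1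
        rw [abs_mul, abs_mul, abs_inv, Real.log_mul (by positivity) (by positivity),
          Real.log_mul (by positivity) (by positivity), Real.log_inv, ← sub_eq_add_neg]
      have e2 : log |M 2 * (M 1)⁻¹| = log |M 2| - log |M 1| := by
        have h1 := (hMu 1).1
        have h2 := (hMu 2).1
        rw [abs_mul, abs_inv, Real.log_mul (by positivity) (by positivity), Real.log_inv,
          ← sub_eq_add_neg]
      refine (congrArg (· - log |lam 0 - lam 1|) e1).trans (Eq.trans ?_
        (congrArg (fun x => (r : ℝ) * x + (log |lam 0 - lam 2| + log |ε 1| -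
          (log |lam 0 - lam 1| + log |ε 2|))) e2.symm))
      rw [hlogρ, hlogρ]
      ring
    · exact abs_ne_zero.2 (mul_ne_zero (mul_ne_zero h02 (hρu _).1) (inv_ne_zero (hρu _).1))
    · exact abs_ne_zero.2 h01
  · refine (abs_log_le_two_mul_abs_sub_one hκle).trans (hsmall.trans (Real.exp_le_exp.2 ?_))
    have : r * (t * (n : ℝ)) ≤ u * n := by rw [← mul_assoc]; gcongr
    linarith

theorem lucas_succ_eq_fib_add_fib (n : ℕ) :
    lucas (n + 1) = (Nat.fib n : ℤ) + (Nat.fib (n + 2) : ℤ) := by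
  induction n using Nat.twoStepInduction with
  | zero => simp [lucas]
  | one => simp [lucas, Nat.fib]
  | more n h1 h2 =>
    rw [lucas, h1, h2]
    have h3 : Nat.fib (n + 4) = Nat.fib (n + 2) + Nat.fib (n + 3) := Nat.fib_add_two
    have h4 : Nat.fib (n + 3) = Nat.fib (n + 1) + Nat.fib (n + 2) := Nat.fib_add_two
    have h5 : Nat.fib (n + 2) = Nat.fib n + Nat.fib (n + 1) := Nat.fib_add_two
    simp only [show n + 2 + 2 = n + 4 from rfl, show n + 1 + 2 = n + 3 from rfl] at *
    push_cast [h3, h4, h5]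
    ring

theorem fib_lucas_bounds {n : ℕ} (hn : 10 ≤ n) :
    55 ≤ Nat.fib n ∧ 2 * (Nat.fib n : ℤ) ≤ lucas n ∧ lucas n ≤ 3 * (Nat.fib n : ℤ) := by
  refine ⟨(by decide : 55 = Nat.fib 10) ▸ Nat.fib_mono hn, ?_⟩
  obtain ⟨m, rfl⟩ : ∃ m, n = m + 2 := ⟨n - 2, by omega⟩
  rw [lucas_succ_eq_fib_add_fib]
  have h1 : Nat.fib (m + 1 + 2) = Nat.fib (m + 1) + Nat.fib (m + 2) := Nat.fib_add_two
  have h2 : Nat.fib (m + 2) = Nat.fib m + Nat.fib (m + 1) := Nat.fib_add_two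
  have h3 : Nat.fib m ≤ Nat.fib (m + 1) := Nat.fib_mono (by omega)
  omega

theorem lucas_add_one_le_exp {n : ℕ} (hn : 10 ≤ n) :
    (lucas n : ℝ) + 1 ≤ exp ((n : ℝ) / 2) ∧ exp ((n : ℝ) / 4) ≤ (lucas n : ℝ) := by
  have he := Real.exp_one_gt_d9
  have he' := Real.exp_one_lt_d9
  have hx : exp (1 / 2) ^ 2 = exp 1 := by rw [← Real.exp_nat_mul]; norm_num
  have hw : exp (1 / 4) ^ 2 = exp (1 / 2) := by rw [← Real.exp_nat_mul]; norm_num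
  have hx0 := Real.exp_pos (1 / 2 : ℝ)
  have hw0 := Real.exp_pos (1 / 4 : ℝ)
  have hx1 : exp (1 / 2) < 1.65 := by nlinarith
  have hx2 : 1.648 < exp (1 / 2) := by nlinarith
  have hw1 : exp (1 / 4) < 1.5 := by nlinarith
  have hw2 : 1 < exp (1 / 4) := by nlinarith
  have hA (k : ℕ) : exp ((k : ℝ) / 2) = exp (1 / 2) ^ k := by
    rw [← Real.exp_nat_mul]; ring_nf
  have hB (k : ℕ) : exp ((k : ℝ) / 4) = exp (1 / 4) ^ k := by
    rw [← Real.exp_nat_mul]; ring_nf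
  rw [hA, hB]
  obtain ⟨m, rfl⟩ := Nat.exists_eq_add_of_le' hn
  clear hn
  set s := exp (1 / 2) with hs
  set w := exp (1 / 4) with hw'
  have hs5 : (124 : ℝ) ≤ s ^ 10 := by
    have : s ^ 10 = exp 1 ^ 5 := by rw [← hx]; ring
    rw [this]
    calc (124 : ℝ) ≤ 2.7 ^ 5 := by norm_num
      _ ≤ exp 1 ^ 5 := by gcongr; linarith
  have hw10 : w ^ 10 ≤ 123 := by
    calc w ^ 10 ≤ 1.5 ^ 10 := by gcongr
      _ ≤ 123 := by norm_num
  induction m using Nat.twoStepInduction with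
  | zero => simp [lucas]; constructor <;> linarith
  | one =>
    simp [lucas]
    rw [pow_succ _ 10, pow_succ _ 10]
    constructor <;> nlinarith
  | more m h1 h2 =>
    have hl : (lucas (m + 2 + 10) : ℝ) = lucas (m + 1 + 10) + lucas (m + 10) := by
      exact_mod_cast (rfl : lucas (m + 10 + 2) = lucas (m + 10 + 1) + lucas (m + 10))
    have e1 (z : ℝ) : z ^ (m + 2 + 10) = z ^ (m + 10) * z ^ 2 := by ring
    have e2 (z : ℝ) : z ^ (m + 1 + 10) = z ^ (m + 10) * z := by ring
    rw [e2] at h2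
    rw [e2] at h2
    rw [e1, e1, hl]
    have p1 : 0 < s ^ (m + 10) := by positivity
    have p2 : 0 < w ^ (m + 10) := by positivity
    have q1 : s ^ (m + 10) * (1 + s) ≤ s ^ (m + 10) * s ^ 2 := by gcongr; linarith
    have q2 : w ^ (m + 10) * w ^ 2 ≤ w ^ (m + 10) * (1 + w) := by gcongr; linarith
    constructor <;> linarith [h1.1, h1.2, h2.1, h2.2]

/-- The cubic `X (X - a) (X - b) - 1` has a root strictly between two points where its signs differ. -/
theorem exists_root_cubic (a b : ℝ) {c d : ℝ} (hcd : c < d)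
    (h : ((c - a) * (c - b) * c - 1) * ((d - a) * (d - b) * d - 1) < 0) :
    ∃ z, c < z ∧ z < d ∧ z * (z - a) * (z - b) = 1 := by
  have hf : ContinuousOn (fun X : ℝ => (X - a) * (X - b) * X - 1) (Set.Icc c d) := by fun_prop
  rcases mul_neg_iff.1 h with ⟨h1, h2⟩ | ⟨h1, h2⟩
  · obtain ⟨z, hz, hz'⟩ := intermediate_value_Ioo' hcd.le hf ⟨h2, h1⟩
    exact ⟨z, hz.1, hz.2, by simp only at hz'; linarith⟩
  · obtain ⟨z, hz, hz'⟩ := intermediate_value_Ioo hcd.le hf ⟨h1, h2⟩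
    exact ⟨z, hz.1, hz.2, by simp only at hz'; linarith⟩

theorem exists_roots {a b : ℝ} (ha : 55 ≤ a) (hab : 2 * a ≤ b) :
    ∃ lam : Fin 3 → ℝ, (0 < lam 0 ∧ lam 0 < 1) ∧ (a - 1 < lam 1 ∧ lam 1 < a) ∧
      (b < lam 2 ∧ lam 2 < b + 1) ∧ ∀ i, lam i * (lam i - a) * (lam i - b) = 1 := by
  obtain ⟨z0, h00, h01, h0⟩ := exists_root_cubic a b (c := 0) (d := 1) (by norm_num) (by nlinarith)
  obtain ⟨z1, h10, h11, h1⟩ := exists_root_cubic a b (c := a - 1) (d := a) (by linarith) (by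
    have : 0 < (a - 1 - a) * (a - 1 - b) * (a - 1) - 1 := by nlinarith
    simp only [sub_self, zero_mul, zero_sub]
    linarith)
  obtain ⟨z2, h20, h21, h2⟩ := exists_root_cubic a b (c := b) (d := b + 1) (by linarith) (by
    have : 0 < (b + 1 - a) * (b + 1 - b) * (b + 1) - 1 := by nlinarith
    simp only [sub_self, zero_mul, mul_zero, zero_sub]
    linarith)
  refine ⟨![z0, z1, z2], ⟨h00, h01⟩, ⟨h10, h11⟩, ⟨h20, h21⟩, fun i => ?_⟩
  fin_cases i
  exacts [h0, h1, h2]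

theorem vieta_cubic {a b z0 z1 z2 : ℝ} (h0 : z0 * (z0 - a) * (z0 - b) = 1)
    (h1 : z1 * (z1 - a) * (z1 - b) = 1) (h2 : z2 * (z2 - a) * (z2 - b) = 1) (h01 : z0 ≠ z1)
    (h02 : z0 ≠ z2) (h12 : z1 ≠ z2) :
    z0 + z1 + z2 = a + b ∧ z0 * z1 + z0 * z2 + z1 * z2 = a * b ∧ z0 * z1 * z2 = 1 := by
  have d1 : z0 ^ 2 + z0 * z1 + z1 ^ 2 - (a + b) * (z0 + z1) + a * b = 0 :=
    mul_left_cancel₀ (sub_ne_zero.2 h01) (by linear_combination h0 - h1)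
  have d2 : z0 ^ 2 + z0 * z2 + z2 ^ 2 - (a + b) * (z0 + z2) + a * b = 0 :=
    mul_left_cancel₀ (sub_ne_zero.2 h02) (by linear_combination h0 - h2)
  have d3 : z0 + z1 + z2 = a + b :=
    mul_left_cancel₀ (sub_ne_zero.2 h12) (by linear_combination d1 - d2)
  have d4 : z0 * z1 + z0 * z2 + z1 * z2 = a * b := by
    linear_combination (z0 + z1) * d3 - d1
  refine ⟨d3, d4, ?_⟩
  linear_combination h0 - z0 ^ 2 * d3 + z0 * d4

theorem exists_int_eq_aeval_esymm {lam : Fin 3 → ℝ} {a b : ℤ}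
    (h1 : lam 0 + lam 1 + lam 2 = a + b)
    (h2 : lam 0 * lam 1 + lam 0 * lam 2 + lam 1 * lam 2 = a * b) (h3 : lam 0 * lam 1 * lam 2 = 1)
    (i : Fin 3) :
    ∃ z : ℤ, (z : ℝ) = MvPolynomial.aeval lam (MvPolynomial.esymm (Fin 3) ℤ (i + 1)) := by
  have p1 : Finset.powersetCard 1 (Finset.univ : Finset (Fin 3)) = {{0}, {1}, {2}} := by decide
  have p2 : Finset.powersetCard 2 (Finset.univ : Finset (Fin 3)) = {{0, 1}, {0, 2}, {1, 2}} := by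
    decide
  have p3 : Finset.powersetCard 3 (Finset.univ : Finset (Fin 3)) = {{0, 1, 2}} := by decide
  fin_cases i
  · refine ⟨a + b, ?_⟩
    simp only [MvPolynomial.esymm, map_sum, map_prod, MvPolynomial.aeval_X, zero_add, p1]
    rw [Finset.sum_insert (by decide), Finset.sum_insert (by decide)]
    push_cast
    simp
    linarith
  · refine ⟨a * b, ?_⟩
    simp only [MvPolynomial.esymm, map_sum, map_prod, MvPolynomial.aeval_X, Nat.reduceAdd, p2]
    rw [Finset.sum_insert (by decide), Finset.sum_insert (by decide)]
    push_cast
    simp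
    linarith
  · refine ⟨1, ?_⟩
    simp only [MvPolynomial.esymm, map_sum, map_prod, MvPolynomial.aeval_X, Nat.reduceAdd, p3]
    simp [← mul_assoc]
    linarith

theorem isConjUnit_of_mul_eq_one {lam v w : Fin 3 → ℝ}
    (hv : ∀ i, (fun σ : Equiv.Perm (Fin 3) => v (σ i)) ∈ conjRing lam)
    (hw : ∀ i, (fun σ : Equiv.Perm (Fin 3) => w (σ i)) ∈ conjRing lam)
    (hvw : ∀ i, v i * w i = 1) : IsConjUnit lam v := fun i => by
  refine ⟨left_ne_zero_of_mul_eq_one (hvw i), hv i, ?_⟩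
  have : ∀ j, (v j)⁻¹ = w j := fun j => inv_eq_of_mul_eq_one_right (hvw j)
  simp only [this]
  exact hw i

theorem intCast_mem_conjRing (lam : Fin 3 → ℝ) (k : ℤ) :
    (fun _ : Equiv.Perm (Fin 3) => (k : ℝ)) ∈ conjRing lam :=
  intCast_mem (conjRing lam) k

section Units

variable {lam : Fin 3 → ℝ} {a b : ℤ}

theorem isConjUnit_root (h : ∀ i, lam i * (lam i - a) * (lam i - b) = 1) : IsConjUnit lam lam :=
  isConjUnit_of_mul_eq_one (coord_mem_conjRing lam)
    (fun i => mul_mem (sub_mem (coord_mem_conjRing lam i) (intCast_mem_conjRing lam a))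
      (sub_mem (coord_mem_conjRing lam i) (intCast_mem_conjRing lam b)))
    (w := fun i => (lam i - a) * (lam i - b)) fun i => by linear_combination h i

theorem isConjUnit_root_sub (h : ∀ i, lam i * (lam i - a) * (lam i - b) = 1) :
    IsConjUnit lam fun i => lam i - a :=
  isConjUnit_of_mul_eq_one
    (fun i => sub_mem (coord_mem_conjRing lam i) (intCast_mem_conjRing lam a))
    (fun i => mul_mem (coord_mem_conjRing lam i)
      (sub_mem (coord_mem_conjRing lam i) (intCast_mem_conjRing lam b)))
    (w := fun i => lam i * (lam i - b)) fun i => by linear_combination h i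

theorem isConjUnit_form (h : ∀ i, lam i * (lam i - a) * (lam i - b) = 1) {x y s : ℤ}
    (hs : s * s = 1) (hxy : (x - a * y) * (x - b * y) * x - y ^ 3 = s) :
    IsConjUnit lam fun i => x - lam i * y := by
  have hl := coord_mem_conjRing lam
  have hk := intCast_mem_conjRing lam
  have hs' : (s : ℝ) * s = 1 := by exact_mod_cast hs
  have hxy' : ((x : ℝ) - a * y) * (x - b * y) * x - y ^ 3 = s := by exact_mod_cast hxy
  refine isConjUnit_of_mul_eq_one (fun i => sub_mem (hk x) (mul_mem (hl i) (hk y)))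
    (w := fun i => s * (x * x + (lam i - a - b) * x * y +
      (lam i * lam i - (a + b) * lam i + a * b) * y * y))
    (fun i => mul_mem (hk s) (add_mem (add_mem (mul_mem (hk x) (hk x)) (mul_mem (mul_mem
      (sub_mem (sub_mem (hl i) (hk a)) (hk b)) (hk x)) (hk y))) (mul_mem (mul_mem (add_mem (sub_mem
      (mul_mem (hl i) (hl i)) (mul_mem (add_mem (hk a) (hk b)) (hl i))) (mul_mem (hk a) (hk b)))
      (hk y)) (hk y)))) fun i => ?_
  linear_combination (-(s : ℝ) * y ^ 3) * h i + (s : ℝ) * hxy' + hs'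

end Units

theorem exists_exponents {l m e : Fin 3 → ℝ} {h : ℝ} (hh : 0 < h) (hl : l 0 + l 1 + l 2 = 0)
    (hm : m 0 + m 1 + m 2 = 0) (he : e 0 + e 1 + e 2 = 0) (hm0 : h / 2 ≤ m 0) (hm0' : m 0 ≤ h)
    (hl1 : h / 2 ≤ l 1) (hl1' : l 1 ≤ h) (hs0 : h / 2 ≤ -l 0 - m 0) (hs0' : -l 0 - m 0 ≤ h)
    (hs1 : h / 2 ≤ -m 1 - l 1) (hs1' : -m 1 - l 1 ≤ h) :
    ∃ u v : ℝ, (∀ i, e i = u * l i + v * m i) ∧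
      ∀ E, (∀ i, |e i| ≤ E) → |u| ≤ 4 * E / h ∧ |v| ≤ 4 * E / h := by
  set q := m 0 with hq
  set q' := l 1 with hq'
  obtain ⟨s, hs⟩ : ∃ s, s = -l 0 - q := ⟨_, rfl⟩
  obtain ⟨s', hs'⟩ : ∃ s', s' = -m 1 - q' := ⟨_, rfl⟩
  rw [← hs] at hs0 hs0'
  rw [← hs'] at hs1 hs1'
  have hl0 : l 0 = -(q + s) := by linarith
  have hm1 : m 1 = -(q' + s') := by linarith
  set D := q * s' + q' * s + s * s' with hD
  have hDh : 3 / 4 * h ^ 2 ≤ D := by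
    have h1 : h / 2 * (h / 2) ≤ q * s' := by gcongr; linarith
    have h2 : h / 2 * (h / 2) ≤ q' * s := by gcongr; linarith
    have h3 : h / 2 * (h / 2) ≤ s * s' := by gcongr; linarith
    nlinarith
  have hD0 : 0 < D := lt_of_lt_of_le (by positivity) hDh
  refine ⟨-((q' + s') * e 0 + q * e 1) / D, -(q' * e 0 + (q + s) * e 1) / D, fun i => ?_,
    fun E hE => ?_⟩
  · have h0 : e 0 = -((q' + s') * e 0 + q * e 1) / D * l 0 +
        -(q' * e 0 + (q + s) * e 1) / D * m 0 := by
      rw [hl0]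
      field_simp
      rw [hD]
      ring
    have h1 : e 1 = -((q' + s') * e 0 + q * e 1) / D * l 1 +
        -(q' * e 0 + (q + s) * e 1) / D * m 1 := by
      rw [hm1]
      field_simp
      rw [hD]
      ring
    fin_cases i
    · exact h0
    · exact h1
    · have e2 : e 2 = -e 0 - e 1 := by linarith
      have l2 : l 2 = -l 0 - l 1 := by linarith
      have m2 : m 2 = -m 0 - m 1 := by linarith
      change e 2 = _ * l 2 + _ * m 2
      rw [l2, m2, e2]
      linear_combination -h0 - h1
  · have hE0 : 0 ≤ E := (abs_nonneg _).trans (hE 0)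
    have key : ∀ c d : ℝ, 0 ≤ c → 0 ≤ d → c + d ≤ 3 * h → |-(c * e 0 + d * e 1) / D| ≤ 4 * E / h := by
      intro c d hc hd hcd
      rw [abs_div, abs_neg, abs_of_pos hD0, div_le_div_iff₀ hD0 hh]
      have h1 : |c * e 0 + d * e 1| ≤ 3 * h * E := by
        refine (abs_add_le _ _).trans ?_
        rw [abs_mul, abs_mul, abs_of_nonneg hc, abs_of_nonneg hd]
        have h2 : c * |e 0| ≤ c * E := by gcongr; exact hE 0
        have h3 : d * |e 1| ≤ d * E := by gcongr; exact hE 1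
        nlinarith
      calc |c * e 0 + d * e 1| * h ≤ 3 * h * E * h := by gcongr
        _ = 4 * E * (3 / 4 * h ^ 2) := by ring
        _ ≤ 4 * E * D := by gcongr
    exact ⟨key _ _ (by linarith) (by linarith) (by linarith),
      key _ _ (by linarith) (by linarith) (by linarith)⟩

section

variable {lam A C ε : Fin 3 → ℝ} {n : ℕ}

theorem false_of_siegel_identity_of_abs_le
    (hlam : ∀ i : Fin 3, ∃ z : ℤ, (z : ℝ) =
      MvPolynomial.aeval lam (MvPolynomial.esymm (Fin 3) ℤ (i + 1)))
    (hA : IsConjUnit lam A) (hC : IsConjUnit lam C) (hε : IsConjUnit lam ε) (hn : 1 ≤ n)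
    (hAn : ∀ i, |log (|A i|)| ≤ n) (hCn : ∀ i, |log (|C i|)| ≤ n)
    (hgap : ∀ i j, i ≠ j → |log (|lam i - lam j|)| ≤ n) (hne : Function.Injective lam) {u v : ℝ}
    (hu : 10 ^ 43 * (n : ℝ) ^ 3 ≤ |u|) (hv : |v| ≤ |u|)
    (huv : ∀ i, log |ε i| = u * log |A i| + v * log |C i|)
    (hsum : (lam 0 - lam 1) * ε 2 + (lam 1 - lam 2) * ε 0 + (lam 2 - lam 0) * ε 1 = 0)
    (hsmall : 2 * |(lam 1 - lam 2) * ε 0 / ((lam 0 - lam 1) * ε 2)| ≤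
      exp (-(27 / 1000 * (|u| * n)))) : False := by
  rcases abs_cases u with ⟨h, -⟩ | ⟨h, -⟩
  · rw [h] at hu hv hsmall
    exact false_of_siegel_identity hlam hA hC hε hn hAn hCn hgap hne hu hv huv hsum hsmall
  · rw [h] at hu hv hsmall
    rw [← abs_neg] at hv
    refine false_of_siegel_identity hlam hA.inv hC.inv hε hn ?_ ?_ hgap hne hu hv ?_ hsum hsmall
    · simpa only [abs_inv, Real.log_inv, abs_neg] using hAn
    · simpa only [abs_inv, Real.log_inv, abs_neg] using hCn
    · simpa only [abs_inv, Real.log_inv, neg_mul_neg] using huv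

theorem log_abs_lt_of_isConjUnit
    (hlam : ∀ i : Fin 3, ∃ z : ℤ, (z : ℝ) =
      MvPolynomial.aeval lam (MvPolynomial.esymm (Fin 3) ℤ (i + 1)))
    (hA : IsConjUnit lam A) (hC : IsConjUnit lam C) {x y h : ℝ}
    (hε : IsConjUnit lam fun i => x - lam i * y) (hn : 1 ≤ n) (hAn : ∀ i, |log (|A i|)| ≤ n)
    (hCn : ∀ i, |log (|C i|)| ≤ n) (hh : 1 ≤ h) (hhn : 2 * h ≤ n) (hnh : n ≤ 4 * h)
    (hgap : ∀ i j, i ≠ j → 2 ≤ |lam i - lam j| ∧ |lam i - lam j| ≤ exp h) {u v : ℝ}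
    (huv : ∀ i, log |x - lam i * y| = u * log |A i| + v * log |C i|)
    (huvE : ∀ E, (∀ i, |log (|x - lam i * y|)| ≤ E) → |u| ≤ 4 * E / h ∧ |v| ≤ 4 * E / h)
    (hprod : |x - lam 0 * y| * |x - lam 1 * y| * |x - lam 2 * y| = 1)
    (hmin : ∀ i, |x - lam 0 * y| ≤ |x - lam i * y|) :
    log |y| < 10 ^ 45 * (n : ℝ) ^ 4 := by
  by_contra! hY
  have hn' : (1 : ℝ) ≤ n := by exact_mod_cast hn
  have hn4 : (n : ℝ) ≤ (n : ℝ) ^ 4 := le_self_pow₀ hn' (by norm_num)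
  have hYn : 10 ^ 45 * (n : ℝ) ≤ log |y| := by linarith
  set Y := log |y| with hYdef
  have hy1 : 1 < |y| := by
    by_contra! hy
    have := Real.log_nonpos (abs_nonneg y) hy
    linarith
  have hε0 : ∀ i, 0 < |x - lam i * y| := fun i => abs_pos.2 (hε i).1
  have hlow : ∀ i, i ≠ 0 → |y| ≤ |x - lam i * y| := by
    intro i hi
    have h1 : 2 * |y| ≤ |lam 0 - lam i| * |y| := by
      gcongr
      exact (hgap 0 i hi.symm).1
    have h2 : |lam 0 - lam i| * |y| ≤ |x - lam i * y| + |x - lam 0 * y| := by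
      rw [← abs_mul]
      refine le_trans (le_of_eq ?_) (abs_sub _ _)
      congr 1
      ring
    linarith [hmin i]
  have hlowlog : ∀ i, i ≠ 0 → Y ≤ log |x - lam i * y| := fun i hi =>
    Real.log_le_log (by linarith) (hlow i hi)
  have hsumlog : log |x - lam 0 * y| + log |x - lam 1 * y| + log |x - lam 2 * y| = 0 := by
    rw [← Real.log_mul (hε0 0).ne' (hε0 1).ne', ← Real.log_mul
      (mul_pos (hε0 0) (hε0 1)).ne' (hε0 2).ne', hprod, Real.log_one]
  have h1Y := hlowlog 1 (by decide)
  have h2Y := hlowlog 2 (by decide)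
  have h0Y : log |x - lam 0 * y| ≤ -(2 * Y) := by linarith
  have h0le : |x - lam 0 * y| ≤ 1 := by
    by_contra! h1
    have := Real.log_pos h1
    linarith
  have hup : ∀ i, i ≠ 0 → log |x - lam i * y| ≤ 2 * h + Y := by
    intro i hi
    have h1 : |lam 0 - lam i| * |y| ≤ exp h * |y| := by
      gcongr
      exact (hgap 0 i hi.symm).2
    have h2 : |x - lam i * y| ≤ |x - lam 0 * y| + |lam 0 - lam i| * |y| := by
      rw [← abs_mul]
      refine le_trans (le_of_eq ?_) (abs_add_le _ _)
      congr 1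
      ring
    have h3 : 2 ≤ exp h := by linarith [Real.add_one_le_exp h]
    have h4 : |x - lam i * y| ≤ exp (2 * h + Y) := by
      have h5 : exp (2 * h + Y) = exp h * exp h * |y| := by
        rw [hYdef, Real.exp_add, Real.exp_log (by linarith), two_mul, Real.exp_add]
      rw [h5]
      have h6 : 2 * exp h ≤ exp h * exp h := by gcongr
      nlinarith
    exact (Real.log_le_iff_le_exp (hε0 i)).2 h4
  have h1up := hup 1 (by decide)
  have h2up := hup 2 (by decide)
  have hE : ∀ i, |log (|x - lam i * y|)| ≤ 2.1 * Y := by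
    intro i
    rw [abs_le]
    fin_cases i
    · change _ ≤ log |x - lam 0 * y| ∧ log |x - lam 0 * y| ≤ _
      constructor <;> linarith
    · change _ ≤ log |x - lam 1 * y| ∧ log |x - lam 1 * y| ≤ _
      constructor <;> linarith
    · change _ ≤ log |x - lam 2 * y| ∧ log |x - lam 2 * y| ≤ _
      constructor <;> linarith
  have hsmall : ∀ w : ℝ, |w| ≤ 4 * (2.1 * Y) / h →
      2 * |(lam 1 - lam 2) * (x - lam 0 * y) / ((lam 0 - lam 1) * (x - lam 2 * y))| ≤
        exp (-(27 / 1000 * (|w| * n))) := by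
    intro w hw
    have h1 : |w| * n ≤ 33.6 * Y := by
      have h2 : |w| * n ≤ 4 * (2.1 * Y) / h * (4 * h) := by
        gcongr
        exact (abs_nonneg w).trans hw
      have h3 : 4 * (2.1 * Y) / h * (4 * h) = 33.6 * Y := by field_simp; ring
      linarith
    have h4 := (hgap 1 2 (by decide)).2
    have h5 := (hgap 0 1 (by decide)).1
    have h6 : exp Y ≤ |x - lam 2 * y| := (Real.le_log_iff_exp_le (hε0 2)).1 h2Y
    have h7 : |x - lam 0 * y| ≤ exp (-(2 * Y)) := (Real.log_le_iff_le_exp (hε0 0)).1 h0Y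
    rw [abs_div, abs_mul, abs_mul]
    calc 2 * (|lam 1 - lam 2| * |x - lam 0 * y| / (|lam 0 - lam 1| * |x - lam 2 * y|))
        ≤ 2 * (exp h * exp (-(2 * Y)) / (2 * exp Y)) := by gcongr
      _ = exp (h - 3 * Y) := by
        rw [show h - 3 * Y = h + -(2 * Y) - Y by ring, Real.exp_sub, Real.exp_add]
        field_simp
      _ ≤ exp (-(27 / 1000 * (|w| * n))) := Real.exp_le_exp.2 (by linarith)
  obtain ⟨huE, hvE⟩ := huvE _ hE
  have hlarge : ∀ w z : ℝ, |z| ≤ |w| → Y ≤ |w| * n + |z| * n → 10 ^ 43 * (n : ℝ) ^ 3 ≤ |w| := by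
    intro w z hzw h1
    by_contra! h2
    have h3 : |z| * n ≤ |w| * n := by gcongr
    have h4 : |w| * n ≤ 10 ^ 43 * (n : ℝ) ^ 3 * n := by gcongr
    have h5 : 10 ^ 43 * (n : ℝ) ^ 3 * n = 10 ^ 43 * (n : ℝ) ^ 4 := by ring
    have h6 : (0 : ℝ) < (n : ℝ) ^ 4 := by positivity
    linarith
  have hYuv : Y ≤ |u| * n + |v| * n := by
    refine h1Y.trans ((le_abs_self _).trans ?_)
    rw [huv]
    refine (abs_add_le _ _).trans ?_
    rw [abs_mul, abs_mul]
    gcongr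
    exacts [hAn 1, hCn 1]
  have hgap' : ∀ i j, i ≠ j → |log (|lam i - lam j|)| ≤ n := by
    intro i j hij
    obtain ⟨h1, h2⟩ := hgap i j hij
    have h3 : log |lam i - lam j| ≤ h := (Real.log_le_iff_le_exp (by linarith)).2 h2
    rw [abs_of_nonneg (Real.log_nonneg (by linarith))]
    linarith
  have hne : Function.Injective lam := by
    intro i j hij
    by_contra h1
    have := (hgap i j h1).1
    rw [hij, sub_self, abs_zero] at this
    linarith
  have hsum : (lam 0 - lam 1) * (x - lam 2 * y) + (lam 1 - lam 2) * (x - lam 0 * y) +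
      (lam 2 - lam 0) * (x - lam 1 * y) = 0 := by ring
  rcases le_total |v| |u| with hvu | hvu
  · exact false_of_siegel_identity_of_abs_le hlam hA hC hε hn hAn hCn hgap' hne
      (hlarge u v hvu hYuv) hvu huv hsum (hsmall u huE)
  · exact false_of_siegel_identity_of_abs_le hlam hC hA hε hn hCn hAn hgap' hne
      (hlarge v u hvu (by linarith)) hvu (fun i => (huv i).trans (add_comm _ _)) hsum (hsmall v hvE)

end

theorem exists_int_eq_aeval_esymm_comp {lam : Fin 3 → ℝ}
    (hlam : ∀ i : Fin 3, ∃ z : ℤ, (z : ℝ) =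
      MvPolynomial.aeval lam (MvPolynomial.esymm (Fin 3) ℤ (i + 1)))
    (τ : Equiv.Perm (Fin 3)) (i : Fin 3) :
    ∃ z : ℤ, (z : ℝ) =
      MvPolynomial.aeval (lam ∘ τ) (MvPolynomial.esymm (Fin 3) ℤ (i + 1)) := by
  obtain ⟨z, hz⟩ := hlam i
  exact ⟨z, by rw [hz, ← MvPolynomial.aeval_rename, MvPolynomial.rename_esymm]⟩

theorem forall_fin_three {P : Fin 3 → Prop} (h0 : P 0) (h1 : P 1) (h2 : P 2) (i : Fin 3) : P i := by
  fin_cases i <;> assumption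

theorem log_abs_lt_of_form_eq {a b : ℤ} (ha : 55 ≤ a) (hab : 2 * a ≤ b) (hab' : b ≤ 3 * a) {n : ℕ}
    (hn : 10 ≤ n) (hbn : (b : ℝ) + 1 ≤ exp ((n : ℝ) / 2)) (hnb : exp ((n : ℝ) / 4) ≤ (b : ℝ))
    {x y s : ℤ} (hs : s * s = 1) (hxy : (x - a * y) * (x - b * y) * x - y ^ 3 = s) :
    log |(y : ℝ)| < 10 ^ 45 * (n : ℝ) ^ 4 ∧ |(x : ℝ)| ≤ 1 + (b + 1) * |(y : ℝ)| := by
  have ha' : (55 : ℝ) ≤ a := by exact_mod_cast ha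
  have hab1 : (2 : ℝ) * a ≤ b := by exact_mod_cast hab
  have hab2 : (b : ℝ) ≤ 3 * a := by exact_mod_cast hab'
  have hn' : (10 : ℝ) ≤ n := by exact_mod_cast hn
  obtain ⟨lam, ⟨h00, h01⟩, ⟨h10, h11⟩, ⟨h20, h21⟩, hroot⟩ := exists_roots ha' hab1
  obtain ⟨he1, he2, he3⟩ := vieta_cubic (hroot 0) (hroot 1) (hroot 2) (by linarith) (by linarith)
    (by linarith)
  have hlam := exists_int_eq_aeval_esymm he1 he2 he3
  obtain ⟨h, hh⟩ : ∃ h, h = log ((b : ℝ) + 1) := ⟨_, rfl⟩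
  have hexp : exp h = b + 1 := by rw [hh, Real.exp_log (by linarith)]
  have hhn : 2 * h ≤ n := by
    have := (Real.log_le_iff_le_exp (by linarith)).2 hbn
    linarith
  have hnh : n ≤ 4 * h := by
    have : (n : ℝ) / 4 ≤ log ((b : ℝ) + 1) :=
      (Real.le_log_iff_exp_le (by linarith)).2 (by linarith)
    linarith
  have hh1 : 1 ≤ h := by linarith
  have hlog : ∀ z : ℝ, a - 1 ≤ z → z ≤ b + 1 → h / 2 ≤ log z ∧ log z ≤ h := by
    intro z hz hz'
    rw [hh]
    refine ⟨?_, Real.log_le_log (by linarith) hz'⟩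
    have h1 : log ((b : ℝ) + 1) ≤ log (z ^ 2) := Real.log_le_log (by linarith) (by nlinarith)
    rw [Real.log_pow] at h1
    push_cast at h1
    linarith
  have hlogsum : ∀ z w t : ℝ, z ≠ 0 → w ≠ 0 → t ≠ 0 → |z * w * t| = 1 →
      log |z| + log |w| + log |t| = 0 := by
    intro z w t hz hw ht h1
    rw [← Real.log_mul (abs_ne_zero.2 hz) (abs_ne_zero.2 hw), ← abs_mul,
      ← Real.log_mul (abs_ne_zero.2 (mul_ne_zero hz hw)) (abs_ne_zero.2 ht), ← abs_mul, h1,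
      Real.log_one]
  have hu1 := isConjUnit_root hroot
  have hu2 := isConjUnit_root_sub hroot
  have hu3 := isConjUnit_form hroot hs hxy
  have hsabs : |(s : ℝ)| = 1 := by
    have : s = 1 ∨ s = -1 := mul_self_eq_one_iff.1 hs
    rcases this with rfl | rfl <;> simp
  have hprod : (x - lam 0 * y) * (x - lam 1 * y) * (x - lam 2 * y) = (s : ℝ) := by
    have hxy' : ((x : ℝ) - a * y) * (x - b * y) * x - y ^ 3 = s := by exact_mod_cast hxy
    linear_combination hxy' - (x : ℝ) ^ 2 * y * he1 + (x : ℝ) * y ^ 2 * he2 - (y : ℝ) ^ 3 * he3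
  have hprod' : |x - lam 0 * y| * |x - lam 1 * y| * |x - lam 2 * y| = (1 : ℝ) := by
    rw [← abs_mul, ← abs_mul, hprod, hsabs]
  have hl := hlogsum _ _ _ (hu1 0).1 (hu1 1).1 (hu1 2).1 (by rw [he3, abs_one])
  have hm := hlogsum _ _ _ (hu2 0).1 (hu2 1).1 (hu2 2).1 (by
    rw [show (lam 0 - a) * (lam 1 - a) * (lam 2 - a) = 1 by
      linear_combination he3 - (a : ℝ) * he2 + (a : ℝ) ^ 2 * he1, abs_one])
  have he := hlogsum _ _ _ (hu3 0).1 (hu3 1).1 (hu3 2).1 (by rw [hprod, hsabs])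
  beta_reduce at hm he
  have hr : ∀ i, log |lam i| + log |lam i - a| + log |lam i - b| = 0 := by
    intro i
    have h1 : lam i - b ≠ 0 := right_ne_zero_of_mul_eq_one (hroot i)
    exact hlogsum _ _ _ (hu1 i).1 (hu2 i).1 h1 (by rw [hroot, abs_one])
  have hr0 := hr 0
  have hr1 := hr 1
  obtain ⟨b1, b2⟩ := hlog |lam 0 - a| (by rw [abs_of_neg] <;> linarith)
    (by rw [abs_of_neg] <;> linarith)
  obtain ⟨b3, b4⟩ := hlog |lam 1| (by rw [abs_of_pos] <;> linarith)
    (by rw [abs_of_pos] <;> linarith)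
  obtain ⟨b5, b6⟩ := hlog |lam 0 - b| (by rw [abs_of_neg] <;> linarith)
    (by rw [abs_of_neg] <;> linarith)
  obtain ⟨b7, b8⟩ := hlog |lam 1 - b| (by rw [abs_of_neg] <;> linarith)
    (by rw [abs_of_neg] <;> linarith)
  obtain ⟨b9, b10⟩ := hlog |lam 2| (by rw [abs_of_pos] <;> linarith)
    (by rw [abs_of_pos] <;> linarith)
  obtain ⟨b11, b12⟩ := hlog |lam 2 - a| (by rw [abs_of_pos] <;> linarith)
    (by rw [abs_of_pos] <;> linarith)
  obtain ⟨u, v, huv, huvE⟩ := exists_exponents (l := fun i => log |lam i|)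
    (m := fun i => log |lam i - a|) (e := fun i => log |x - lam i * y|) (h := h) (by linarith)
    hl hm he b1 b2 b3 b4 (by linarith) (by linarith) (by linarith) (by linarith)
  have hAn : ∀ i, |log (|lam i|)| ≤ n :=
    forall_fin_three (abs_le.2 ⟨by linarith, by linarith⟩) (abs_le.2 ⟨by linarith, by linarith⟩)
      (abs_le.2 ⟨by linarith, by linarith⟩)
  have hCn : ∀ i, |log (|lam i - a|)| ≤ n :=
    forall_fin_three (abs_le.2 ⟨by linarith, by linarith⟩) (abs_le.2 ⟨by linarith, by linarith⟩)
      (abs_le.2 ⟨by linarith, by linarith⟩)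
  have hgap : ∀ i j, i < j → 2 ≤ lam j - lam i ∧ lam j - lam i ≤ exp h := by
    rw [hexp]
    intro i j hij
    fin_cases i <;> fin_cases j <;> first
      | exact absurd hij (by decide)
      | (simp only [Fin.zero_eta, Fin.mk_one, Fin.reduceFinMk]
         constructor <;> linarith)
  have hgap' : ∀ i j, i ≠ j → 2 ≤ |lam i - lam j| ∧ |lam i - lam j| ≤ exp h := by
    intro i j hij
    rcases hij.lt_or_gt with h1 | h1
    · rw [abs_sub_comm, abs_of_nonneg (by linarith [hgap _ _ h1])]
      exact hgap _ _ h1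
    · rw [abs_of_nonneg (by linarith [hgap _ _ h1])]
      exact hgap _ _ h1
  obtain ⟨k, hk⟩ := Finite.exists_min fun i => |(x : ℝ) - lam i * y|
  constructor
  · set τ := Equiv.swap 0 k with hτ
    refine log_abs_lt_of_isConjUnit (lam := lam ∘ τ) (A := fun i => lam (τ i))
      (C := fun i => lam (τ i) - a) (x := x) (h := h) (u := u) (v := v)
      (exists_int_eq_aeval_esymm_comp hlam τ) (isConjUnit_root (fun i => hroot (τ i)))
      (isConjUnit_root_sub (fun i => hroot (τ i)))
      (isConjUnit_form (fun i => hroot (τ i)) hs hxy) (by omega) (fun i => hAn _) (fun i => hCn _)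
      hh1 hhn hnh (fun i j hij => hgap' _ _ (τ.injective.ne hij)) (fun i => huv _)
      (fun E hE => huvE E fun i => ?_) ?_ (fun i => ?_)
    · simpa using hE (τ.symm i)
    · have h1 := Equiv.prod_comp τ fun i => |(x : ℝ) - lam i * y|
      rw [Fin.prod_univ_three, Fin.prod_univ_three] at h1
      exact h1.trans hprod'
    · have h1 : τ 0 = k := Equiv.swap_apply_left 0 k
      simp only [Function.comp_apply, h1]
      exact hk _
  · have hk1 : |(x : ℝ) - lam k * y| ≤ 1 := by
      by_contra! h1
      have h2 : 1 * 1 * 1 < |x - lam 0 * y| * |x - lam 1 * y| * |x - lam 2 * y| := by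
        gcongr
        exacts [h1.trans_le (hk 0), h1.trans_le (hk 1), h1.trans_le (hk 2)]
      linarith
    have hlk : |lam k| ≤ b + 1 := by
      rw [← hexp]
      exact (Real.log_le_iff_le_exp (abs_pos.2 (hu1 k).1)).1 (by
        have : ∀ i, log |lam i| ≤ h := forall_fin_three (by linarith) b4 b10
        exact this k)
    calc |(x : ℝ)| = |(x - lam k * y) + lam k * y| := by rw [sub_add_cancel]
      _ ≤ |(x : ℝ) - lam k * y| + |lam k * y| := abs_add_le _ _
      _ ≤ 1 + (b + 1) * |(y : ℝ)| := by rw [abs_mul]; gcongr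

theorem le_upper_bound {n : ℕ} (hn : 10 ≤ n) :
    10 ^ 45 * (n : ℝ) ^ 4 + n ≤ 3 ^ 94 * (2 * (n : ℝ) ^ 2) * Real.log (2 * (n : ℝ) ^ 2) *
      (2 * (n : ℝ) ^ 2 + (2 * (n : ℝ) - 1) * Real.log alpha + 1) := by
  have hn' : (10 : ℝ) ≤ n := by exact_mod_cast hn
  have halpha : 0 ≤ log alpha := by
    refine Real.log_nonneg ?_
    have : (1 : ℝ) ≤ √5 := Real.one_le_sqrt.2 (by norm_num)
    unfold alpha
    linarith
  have hlog : 1 ≤ log (2 * (n : ℝ) ^ 2) := by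
    rw [Real.le_log_iff_exp_le (by positivity)]
    have := Real.exp_one_lt_d9
    nlinarith
  have h1 : 2 * (n : ℝ) ^ 2 ≤ 2 * (n : ℝ) ^ 2 + (2 * (n : ℝ) - 1) * log alpha + 1 := by
    have : 0 ≤ (2 * (n : ℝ) - 1) * log alpha := mul_nonneg (by linarith) halpha
    linarith
  have hn4 : (n : ℝ) ≤ (n : ℝ) ^ 4 := le_self_pow₀ (by linarith) (by norm_num)
  calc 10 ^ 45 * (n : ℝ) ^ 4 + n ≤ 3 ^ 94 * (2 * (n : ℝ) ^ 2) * 1 * (2 * (n : ℝ) ^ 2) := by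
        have h2 : 3 ^ 94 * (2 * (n : ℝ) ^ 2) * 1 * (2 * (n : ℝ) ^ 2) =
          4 * 3 ^ 94 * (n : ℝ) ^ 4 := by ring
        rw [h2]
        have h3 : (10 ^ 45 + 1) * (n : ℝ) ^ 4 ≤ 4 * 3 ^ 94 * (n : ℝ) ^ 4 := by
          gcongr
          norm_num
        linarith
    _ ≤ _ := by gcongr

theorem log_xy_upper_bound (n : ℕ) (hn : 10 ≤ n) (x y : ℤ)
    (heq : (x - (Nat.fib n : ℤ) * y) * (x - lucas n * y) * x - y ^ 3 = 1 ∨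
      (x - (Nat.fib n : ℤ) * y) * (x - lucas n * y) * x - y ^ 3 = -1) :
    (x ≠ 0 → Real.log |(x : ℝ)| ≤
      3 ^ 94 * (2 * (n : ℝ) ^ 2) * Real.log (2 * (n : ℝ) ^ 2) *
        (2 * (n : ℝ) ^ 2 + (2 * (n : ℝ) - 1) * Real.log alpha + 1)) ∧
    (y ≠ 0 → Real.log |(y : ℝ)| ≤
      3 ^ 94 * (2 * (n : ℝ) ^ 2) * Real.log (2 * (n : ℝ) ^ 2) *
        (2 * (n : ℝ) ^ 2 + (2 * (n : ℝ) - 1) * Real.log alpha + 1)) := by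
  obtain ⟨ha, hab, hab'⟩ := fib_lucas_bounds hn
  obtain ⟨hbn, hnb⟩ := lucas_add_one_le_exp hn
  obtain ⟨s, hs, hxy⟩ : ∃ s : ℤ, s * s = 1 ∧
      (x - (Nat.fib n : ℤ) * y) * (x - lucas n * y) * x - y ^ 3 = s := by
    rcases heq with h | h
    exacts [⟨1, rfl, h⟩, ⟨-1, rfl, h⟩]
  obtain ⟨hy, hx⟩ := log_abs_lt_of_form_eq (by exact_mod_cast ha) hab hab' hn hbn hnb hs hxy
  have hB := le_upper_bound hn
  have hn' : (10 : ℝ) ≤ n := by exact_mod_cast hn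
  refine ⟨fun hx0 => le_trans ?_ hB, fun _ => by linarith⟩
  have hx0' : 0 < |(x : ℝ)| := abs_pos.2 (by exact_mod_cast hx0)
  rcases eq_or_ne y 0 with rfl | hy0
  · have h1 : log |(x : ℝ)| ≤ 0 := Real.log_nonpos (abs_nonneg _) (by simpa using hx)
    have h2 : 0 ≤ 10 ^ 45 * (n : ℝ) ^ 4 + n := by positivity
    linarith
  · have hy1 : 1 ≤ |(y : ℝ)| := by exact_mod_cast Int.one_le_abs hy0
    have hE : 2 ≤ exp ((n : ℝ) / 2) := by linarith [Real.add_one_le_exp ((n : ℝ) / 2)]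
    have hxn : |(x : ℝ)| ≤ exp (n + log |(y : ℝ)|) := by
      have h1 : exp (n + log |(y : ℝ)|) = exp ((n : ℝ) / 2) * exp ((n : ℝ) / 2) * |(y : ℝ)| := by
        rw [Real.exp_add, Real.exp_log (by linarith), ← Real.exp_add, add_halves]
      have h2 : ((lucas n : ℝ) + 1) * |(y : ℝ)| ≤ exp ((n : ℝ) / 2) * |(y : ℝ)| := by gcongr
      have h3 : 2 * exp ((n : ℝ) / 2) ≤ exp ((n : ℝ) / 2) * exp ((n : ℝ) / 2) := by gcongr
      rw [h1]
      nlinarith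
    have := (Real.log_le_iff_le_exp hx0').2 hxn
    linarith
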